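/- arXiv:1008.0964 — 10 statements merged into one kernel-verified Lean document; each statement's English description precedes it below -/
import Mathlib

section
/- Let u ≠ 0 in ℝⁿ, let F = {x ∈ ℝⁿ : ⟨x,u⟩ = 0}, and let A be a real symmetric n×n matrix of negative type on F but not of negative type on ℝⁿ. Then A is of strict negative type on F if and only if A is nonsingular and ⟨A⁻¹u, u⟩ ≠ 0. -/
open Matrix

section

variable {ι : Type*} [Fintype ι]

theorem Matrix.IsSymm.mulVec_dotProduct_comm {A : Matrix ι ι ℝ} (hA : A.IsSymm) (x y : ι → ℝ) :
    A *ᵥ x ⬝ᵥ y = A *ᵥ y ⬝ᵥ x := by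
  rw [dotProduct_comm, dotProduct_mulVec, ← mulVec_transpose, hA.eq]

theorem Matrix.IsSymm.mulVec_smul_add_dotProduct_self {A : Matrix ι ι ℝ} (hA : A.IsSymm)
    (t : ℝ) (x y : ι → ℝ) :
    A *ᵥ (t • x + y) ⬝ᵥ (t • x + y) =
      t ^ 2 * (A *ᵥ x ⬝ᵥ x) + 2 * t * (A *ᵥ x ⬝ᵥ y) + A *ᵥ y ⬝ᵥ y := by
  simp only [mulVec_add, mulVec_smul, add_dotProduct, dotProduct_add, smul_dotProduct,
    dotProduct_smul, smul_eq_mul, hA.mulVec_dotProduct_comm y x]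
  ring

/-- A null vector of a form of negative type on a hyperplane is orthogonal, for the form, to the
whole hyperplane. -/
theorem Matrix.IsSymm.mulVec_dotProduct_eq_zero_of_negType {A : Matrix ι ι ℝ} (hA : A.IsSymm)
    {u x y : ι → ℝ} (hneg : ∀ x : ι → ℝ, x ⬝ᵥ u = 0 → A *ᵥ x ⬝ᵥ x ≤ 0)
    (hx : x ⬝ᵥ u = 0) (hAx : A *ᵥ x ⬝ᵥ x = 0) (hy : y ⬝ᵥ u = 0) : A *ᵥ x ⬝ᵥ y = 0 := by
  by_contra hb
  have h := hneg (((1 - A *ᵥ y ⬝ᵥ y) / (2 * (A *ᵥ x ⬝ᵥ y))) • x + y)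
    (by simp [add_dotProduct, smul_dotProduct, hx, hy])
  rw [hA.mulVec_smul_add_dotProduct_self, hAx, mul_zero, zero_add, mul_right_comm,
    mul_div_cancel₀ _ (mul_ne_zero two_ne_zero hb)] at h
  linarith

theorem exists_eq_smul_of_forall_dotProduct_eq_zero {u z : ι → ℝ} (hu : u ≠ 0)
    (hz : ∀ y : ι → ℝ, y ⬝ᵥ u = 0 → z ⬝ᵥ y = 0) : ∃ c : ℝ, z = c • u := by
  have huu : u ⬝ᵥ u ≠ 0 := fun h => hu (dotProduct_self_eq_zero.mp h)
  refine ⟨(z ⬝ᵥ u) / (u ⬝ᵥ u), ?_⟩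
  set c := (z ⬝ᵥ u) / (u ⬝ᵥ u) with hc
  have hy : (z - c • u) ⬝ᵥ u = 0 := by
    rw [sub_dotProduct, smul_dotProduct, smul_eq_mul, hc]
    field_simp
    ring
  rw [← sub_eq_zero, ← dotProduct_self_eq_zero, sub_dotProduct, hz _ hy, smul_dotProduct,
    dotProduct_comm u, hy]
  simp

/-- A symmetric matrix of strict negative type on a hyperplane that takes a positive value is
nonsingular. -/
theorem Matrix.IsSymm.det_ne_zero_of_strict_negType [DecidableEq ι] {A : Matrix ι ι ℝ}
    (hA : A.IsSymm) {u : ι → ℝ} (hneg : ∀ x : ι → ℝ, x ⬝ᵥ u = 0 → A *ᵥ x ⬝ᵥ x ≤ 0)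
    (hnot : ∃ w : ι → ℝ, 0 < A *ᵥ w ⬝ᵥ w)
    (hstrict : ∀ x : ι → ℝ, x ⬝ᵥ u = 0 → A *ᵥ x ⬝ᵥ x = 0 → x = 0) : A.det ≠ 0 := by
  intro hdet
  obtain ⟨x, hx, hAx⟩ := exists_mulVec_eq_zero_iff.mpr hdet
  have hxu : x ⬝ᵥ u ≠ 0 := fun h => hx (hstrict x h (by simp [hAx]))
  obtain ⟨w, hw⟩ := hnot
  have h := hneg ((-(w ⬝ᵥ u) / (x ⬝ᵥ u)) • x + w) (by
    rw [add_dotProduct, smul_dotProduct, smul_eq_mul]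
    field_simp
    ring)
  rw [hA.mulVec_smul_add_dotProduct_self, hAx] at h
  simp only [zero_dotProduct, mul_zero, zero_add] at h
  exact absurd hw h.not_gt

end

/-- Let `u ≠ 0` in `ℝⁿ`, `F = {x : ⟨x,u⟩ = 0}`, and let `A` be a real symmetric
`n×n` matrix of negative type on `F` but not of negative type on `ℝⁿ`. Then `A` is of strict
negative type on `F` iff `A` is nonsingular and `⟨A⁻¹u,u⟩ ≠ 0`. -/
theorem gap_strict_negType_iff {n : ℕ} (u : Fin n → ℝ) (hu : u ≠ 0)
    (A : Matrix (Fin n) (Fin n) ℝ) (hA : A.IsSymm)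
    (hneg : ∀ x : Fin n → ℝ, x ⬝ᵥ u = 0 → A.mulVec x ⬝ᵥ x ≤ 0)
    (hnot : ∃ w : Fin n → ℝ, 0 < A.mulVec w ⬝ᵥ w) :
    (∀ x : Fin n → ℝ, x ⬝ᵥ u = 0 → A.mulVec x ⬝ᵥ x = 0 → x = 0) ↔
      (A.det ≠ 0 ∧ A⁻¹.mulVec u ⬝ᵥ u ≠ 0) := by
  constructor
  · intro hstrict
    have hdet := hA.det_ne_zero_of_strict_negType hneg hnot hstrict
    refine ⟨hdet, fun h => hu ?_⟩
    have hAv : A *ᵥ (A⁻¹ *ᵥ u) = u := by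
      rw [mulVec_mulVec, mul_nonsing_inv A hdet.isUnit, one_mulVec]
    have hv : A⁻¹ *ᵥ u = 0 := hstrict _ h (by rw [hAv, dotProduct_comm, h])
    rw [← hAv, hv, mulVec_zero]
  · rintro ⟨hdet, hv⟩ x hx hAx
    obtain ⟨c, hc⟩ := exists_eq_smul_of_forall_dotProduct_eq_zero hu
      fun y hy => hA.mulVec_dotProduct_eq_zero_of_negType hneg hx hAx hy
    have hxc : x = c • (A⁻¹ *ᵥ u) := by
      rw [← mulVec_smul, ← hc, mulVec_mulVec, nonsing_inv_mul A hdet.isUnit, one_mulVec]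
    rw [hxc, smul_dotProduct, smul_eq_mul] at hx
    rw [hxc, (mul_eq_zero.mp hx).resolve_right hv, zero_smul]
end

section
/- Let (X,d) with X = {x₁,…,xₙ}, n ≥ 2, be a finite metric space of p-negative type (p ≥ 0), and let A = (d(xᵢ,xⱼ)ᵖ)ⁿᵢ,ⱼ₌₁ be its p-distance matrix. Then (X,d) is of strict p-negative type if and only if A is nonsingular and ⟨A⁻¹𝟙, 𝟙⟩ ≠ 0, where 𝟙 = (1,1,…,1)ᵀ. -/
open Matrix

/-- `d^p` with the convention `0^0 = 0` (so `d(x,y)^0 = 0` when `x = y`). -/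
noncomputable def dpow (t p : ℝ) : ℝ := if t = 0 then 0 else t ^ p

/-- A metric space has `p`-negative type. -/
def PNegType (X : Type*) [MetricSpace X] (p : ℝ) : Prop :=
  ∀ (m : ℕ) (y : Fin m → X) (α : Fin m → ℝ), (∑ i, α i) = 0 →
    ∑ i, ∑ j, α i * α j * dpow (dist (y i) (y j)) p ≤ 0

/-- A metric space has strict `p`-negative type. -/
def StrictPNegType (X : Type*) [MetricSpace X] (p : ℝ) : Prop :=
  PNegType X p ∧
    ∀ (m : ℕ) (y : Fin m → X) (α : Fin m → ℝ), (∑ i, α i) = 0 →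
      Function.Injective y →
      ∑ i, ∑ j, α i * α j * dpow (dist (y i) (y j)) p = 0 → α = 0

lemma sum_mul_extend {m n : Type*} [Fintype m] [Fintype n] {f : m → n}
    (hf : Function.Injective f) (α : m → ℝ) (g : n → ℝ) :
    ∑ k, Function.extend f α 0 k * g k = ∑ i, α i * g (f i) := by
  symm
  refine Fintype.sum_of_injective f hf _ _ (fun k hk => ?_) fun i => ?_
  · rw [Function.extend_apply' _ _ _ hk]
    simp
  · rw [hf.extend_apply]

lemma dotProduct_mulVec_eq_sum {n : Type*} [Fintype n] (A : Matrix n n ℝ) (v : n → ℝ) :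
    v ⬝ᵥ A *ᵥ v = ∑ i, ∑ j, v i * v j * A i j := by
  simp only [dotProduct, mulVec, Finset.mul_sum]
  exact Finset.sum_congr rfl fun i _ => Finset.sum_congr rfl fun j _ => by ring

/-- For a finite metric space, strict `p`-negative type is tested on the distance matrix. -/
lemma strictPNegType_iff_dotProduct {n : ℕ} {p : ℝ} {X : Type*} [MetricSpace X]
    (x : Fin n ≃ X) (hX : PNegType X p) {A : Matrix (Fin n) (Fin n) ℝ}
    (hA : ∀ i j, A i j = dpow (dist (x i) (x j)) p) :
    StrictPNegType X p ↔ ∀ v : Fin n → ℝ, ∑ i, v i = 0 → v ⬝ᵥ A *ᵥ v = 0 → v = 0 := by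
  constructor
  · intro h v hv hq
    refine h.2 n x v hv x.injective ?_
    simpa only [dotProduct_mulVec_eq_sum, hA] using hq
  · refine fun h => ⟨hX, fun m y α hα hy hq => ?_⟩
    have hf : Function.Injective (x.symm ∘ y) := x.symm.injective.comp hy
    have hzero := h (Function.extend (x.symm ∘ y) α 0) ?_ ?_
    · ext i
      have := congrFun hzero ((x.symm ∘ y) i)
      rwa [hf.extend_apply] at this
    · simpa [hα] using sum_mul_extend hf α 1
    · rw [← hq]
      simp only [dotProduct, sum_mul_extend hf, mulVec, mul_comm (A _ _)]
      simp only [hA, Finset.mul_sum, mul_assoc, Function.comp_apply, Equiv.apply_symm_apply]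

lemma dotProduct_mulVec_comm_of_isSymm {n : Type*} [Fintype n] {A : Matrix n n ℝ}
    (hA : A.IsSymm) (u v : n → ℝ) : u ⬝ᵥ A *ᵥ v = v ⬝ᵥ A *ᵥ u := by
  rw [dotProduct_mulVec, ← mulVec_transpose, hA.eq, dotProduct_comm]

/-- A zero of a quadratic form that is nonpositive on the hyperplane of zero-sum vectors is
orthogonal, for that form, to the hyperplane. -/
lemma dotProduct_mulVec_eq_zero {n : Type*} [Fintype n] {A : Matrix n n ℝ} (hA : A.IsSymm)
    (hneg : ∀ v : n → ℝ, ∑ i, v i = 0 → v ⬝ᵥ A *ᵥ v ≤ 0) {u w : n → ℝ}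
    (hu : ∑ i, u i = 0) (hw : ∑ i, w i = 0) (hq : w ⬝ᵥ A *ᵥ w = 0) :
    u ⬝ᵥ A *ᵥ w = 0 := by
  have key (t : ℝ) : 2 * t * (u ⬝ᵥ A *ᵥ w) + t ^ 2 * (u ⬝ᵥ A *ᵥ u) ≤ 0 := by
    have h := hneg (w + t • u) (by simp [Finset.sum_add_distrib, ← Finset.mul_sum, hu, hw])
    simp only [mulVec_add, mulVec_smul, dotProduct_add, add_dotProduct, dotProduct_smul,
      smul_dotProduct, smul_eq_mul, hq, dotProduct_mulVec_comm_of_isSymm hA w u] at h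
    linarith
  have hQ := hneg u hu
  set b := u ⬝ᵥ A *ᵥ w
  set c := u ⬝ᵥ A *ᵥ u
  by_contra hb
  have h := key (b / (1 - c))
  have hc : 0 < 1 - c := by linarith
  have hpos : 0 < b ^ 2 / (1 - c) ^ 2 := by positivity
  have heq : 2 * (b / (1 - c)) * b + (b / (1 - c)) ^ 2 * c
      = b ^ 2 / (1 - c) ^ 2 * (2 - c) := by
    field_simp
    ring
  nlinarith

/-- A symmetric matrix of order at least two with zero diagonal is nonsingular if its quadratic
form is anisotropic on the hyperplane of zero-sum vectors. -/
lemma det_ne_zero_of_anisotropic {n : Type*} [Fintype n] [DecidableEq n] [Nontrivial n]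
    {A : Matrix n n ℝ} (hA : A.IsSymm) (hdiag : ∀ i, A i i = 0)
    (h : ∀ v : n → ℝ, ∑ i, v i = 0 → v ⬝ᵥ A *ᵥ v = 0 → v = 0) : A.det ≠ 0 := by
  intro hdet
  obtain ⟨v, hv, hAv⟩ := exists_mulVec_eq_zero_iff.mpr hdet
  have hs : ∑ i, v i ≠ 0 := fun hs => hv (h v hs (by simp [hAv]))
  have hsingle (i : n) : Pi.single i 1 = (∑ k, v k)⁻¹ • v := by
    refine sub_eq_zero.mp (h _ ?_ ?_)
    · simp [Finset.sum_sub_distrib, ← Finset.mul_sum, hs]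
    · simp only [mulVec_sub, mulVec_smul, hAv, smul_zero, sub_zero, sub_dotProduct,
        smul_dotProduct]
      rw [dotProduct_mulVec_comm_of_isSymm hA v, hAv]
      simp [hdiag]
  obtain ⟨i, j, hij⟩ := exists_pair_ne n
  have := congrFun ((hsingle i).trans (hsingle j).symm) i
  simp [hij] at this

/-- A finite metric space `X = {x₁,…,xₙ}` (`n ≥ 2`) of `p`-negative type is of
strict `p`-negative type iff the matrix `A = (d(xᵢ,xⱼ)ᵖ)` is nonsingular and
`⟨A⁻¹𝟙,𝟙⟩ ≠ 0`. -/
theorem strict_pNegType_iff_matrix {n : ℕ} (hn : 2 ≤ n) (p : ℝ) (hp : 0 ≤ p)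
    (X : Type*) [MetricSpace X] (x : Fin n ≃ X) (hX : PNegType X p)
    (A : Matrix (Fin n) (Fin n) ℝ)
    (hA : ∀ i j, A i j = dpow (dist (x i) (x j)) p) :
    StrictPNegType X p ↔
      (A.det ≠ 0 ∧ A⁻¹.mulVec (fun _ => 1) ⬝ᵥ (fun _ => 1) ≠ 0) := by
  have hsymm : A.IsSymm := by
    ext i j
    rw [transpose_apply, hA, hA, dist_comm]
  have hneg (v : Fin n → ℝ) (hv : ∑ i, v i = 0) : v ⬝ᵥ A *ᵥ v ≤ 0 := by
    simpa only [dotProduct_mulVec_eq_sum, hA] using hX n x v hv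
  have : Nontrivial (Fin n) := Fin.nontrivial_iff_two_le.mpr hn
  obtain ⟨i₀⟩ : Nonempty (Fin n) := inferInstance
  rw [strictPNegType_iff_dotProduct x hX hA]
  constructor
  · intro h
    have hdet := det_ne_zero_of_anisotropic hsymm (fun i => by simp [hA, dpow]) h
    refine ⟨hdet, fun hs => ?_⟩
    have hAv : A *ᵥ (A⁻¹ *ᵥ fun _ => 1) = fun _ => 1 := by
      rw [mulVec_mulVec, mul_nonsing_inv _ hdet.isUnit, one_mulVec]
    have hv := h (A⁻¹ *ᵥ fun _ => 1) (by simpa [dotProduct] using hs) (by rw [hAv, hs])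
    rw [hv, mulVec_zero] at hAv
    simpa using congrFun hAv i₀
  · rintro ⟨hdet, hs⟩ w hw hq
    have hAw : A *ᵥ w = (A *ᵥ w) i₀ • fun _ => 1 := by
      ext i
      have := dotProduct_mulVec_eq_zero hsymm hneg
        (u := Pi.single i 1 - Pi.single i₀ 1) (by simp) hw hq
      rw [sub_dotProduct, single_one_dotProduct, single_one_dotProduct, sub_eq_zero] at this
      simpa using this
    have hw' : w = (A *ᵥ w) i₀ • A⁻¹ *ᵥ fun _ => 1 := by
      rw [← mulVec_smul, ← hAw, mulVec_mulVec, nonsing_inv_mul _ hdet.isUnit, one_mulVec]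
    have hc : (A *ᵥ w) i₀ * (A⁻¹ *ᵥ (fun _ => 1) ⬝ᵥ fun _ => 1) = 0 := by
      rw [← smul_eq_mul, ← smul_dotProduct, ← hw']
      simpa [dotProduct] using hw
    rw [hw', (mul_eq_zero.mp hc).resolve_right hs, zero_smul]
end

section
/- Let u ≠ 0 in ℝⁿ, F = {x ∈ ℝⁿ : ⟨x,u⟩ = 0}, F₁ = {x ∈ ℝⁿ : ⟨x,u⟩ = 1}, and let A be a real symmetric n×n matrix of strict negative type on F but not of negative type on ℝⁿ. Let M = sup_{x ∈ F₁} ⟨Ax,x⟩ and let z ∈ F₁ be the unique element with ⟨Az,z⟩ = M. Then the matrix C = M·u·uᵀ − A is positive semi-definite on ℝⁿ and its kernel equals the one-dimensional span of z. -/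
open Matrix

/-- A linear functional on a subspace on which the quadratic form of `A` is anisotropic is
represented by the bilinear form of `A`. -/
lemma exists_mem_forall_dotProduct_mulVec_eq {n : ℕ} (A : Matrix (Fin n) (Fin n) ℝ)
    (F : Submodule ℝ (Fin n → ℝ)) (hF : ∀ x ∈ F, x ⬝ᵥ A *ᵥ x = 0 → x = 0)
    (f : Module.Dual ℝ F) :
    ∃ x ∈ F, ∀ y : F, x ⬝ᵥ A *ᵥ y = f y := by
  let φ : F →ₗ[ℝ] Module.Dual ℝ F := (Matrix.toBilin' A).restrict F
  have hφ (x y : F) : φ x y = (x : Fin n → ℝ) ⬝ᵥ A *ᵥ y := Matrix.toBilin'_apply' A x y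
  have hinj : Function.Injective φ := by
    rw [injective_iff_map_eq_zero]
    intro x hx
    exact Subtype.ext (hF x x.2 (by rw [← hφ, hx, LinearMap.zero_apply]))
  obtain ⟨x, hx⟩ := (LinearMap.injective_iff_surjective_of_finrank_eq_finrank
    Subspace.dual_finrank_eq.symm).1 hinj f
  exact ⟨x, x.2, fun y ↦ by rw [← hφ, hx]⟩

/-- A symmetric matrix with anisotropic quadratic form on `u^⊥` has a point `p` of the hyperplane
`⟨x, u⟩ = 1` at which `A p` is orthogonal to `u^⊥`. -/
lemma exists_dotProduct_eq_one_and_orthogonal {n : ℕ} (u : Fin n → ℝ)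
    (A : Matrix (Fin n) (Fin n) ℝ) (hA : A.IsSymm)
    (hstrict : ∀ x : Fin n → ℝ, x ⬝ᵥ u = 0 → A *ᵥ x ⬝ᵥ x = 0 → x = 0)
    (z : Fin n → ℝ) (hz : z ⬝ᵥ u = 1) :
    ∃ p : Fin n → ℝ, p ⬝ᵥ u = 1 ∧ ∀ y : Fin n → ℝ, y ⬝ᵥ u = 0 → A *ᵥ p ⬝ᵥ y = 0 := by
  let F : Submodule ℝ (Fin n → ℝ) :=
    { carrier := {x | x ⬝ᵥ u = 0}
      add_mem' := fun {a b} (ha : a ⬝ᵥ u = 0) (hb : b ⬝ᵥ u = 0) ↦ by simp [add_dotProduct, ha, hb]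
      zero_mem' := by simp
      smul_mem' := fun c x (hx : x ⬝ᵥ u = 0) ↦ by simp [smul_dotProduct, hx] }
  obtain ⟨x, hx, h⟩ := exists_mem_forall_dotProduct_mulVec_eq A F
    (fun x hx h ↦ hstrict x hx (by rwa [dotProduct_comm]))
    ((Matrix.toBilin' A z).comp F.subtype)
  have hxu : x ⬝ᵥ u = 0 := hx
  refine ⟨z - x, by rw [sub_dotProduct, hz, hxu, sub_zero], fun y hy ↦ ?_⟩
  have hxy : x ⬝ᵥ A *ᵥ y = z ⬝ᵥ A *ᵥ y := (h ⟨y, hy⟩).trans (Matrix.toBilin'_apply' A z y)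
  rw [← hA.eq, mulVec_transpose, ← dotProduct_mulVec, sub_dotProduct, hxy, sub_self]

/-- If `A p` is orthogonal to `y`, the quadratic form of `A` splits on `s p + y`. -/
lemma mulVec_dotProduct_smul_add_self {n : ℕ} (A : Matrix (Fin n) (Fin n) ℝ) (hA : A.IsSymm)
    (p y : Fin n → ℝ) (h : A *ᵥ p ⬝ᵥ y = 0) (s : ℝ) :
    A *ᵥ (s • p + y) ⬝ᵥ (s • p + y) = s ^ 2 * (A *ᵥ p ⬝ᵥ p) + A *ᵥ y ⬝ᵥ y := by
  have h' : A *ᵥ y ⬝ᵥ p = 0 := by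
    rw [dotProduct_comm, dotProduct_mulVec, ← mulVec_transpose, hA.eq, h]
  simp only [mulVec_add, mulVec_smul, add_dotProduct, dotProduct_add, smul_dotProduct,
    dotProduct_smul, smul_eq_mul, h, h']
  ring

/-- With `M = sup_{x ∈ F₁} ⟨Ax,x⟩` and `z ∈ F₁` the unique maximal element,
the matrix `C = M·uuᵀ − A` is positive semi-definite on `ℝⁿ` and its kernel is the
one-dimensional span of `z`. -/
theorem gap_C_psd_ker {n : ℕ} (u : Fin n → ℝ) (hu : u ≠ 0)
    (A : Matrix (Fin n) (Fin n) ℝ) (hA : A.IsSymm)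
    (hneg : ∀ x : Fin n → ℝ, x ⬝ᵥ u = 0 → A.mulVec x ⬝ᵥ x ≤ 0)
    (hstrict : ∀ x : Fin n → ℝ, x ⬝ᵥ u = 0 → A.mulVec x ⬝ᵥ x = 0 → x = 0)
    (hnot : ∃ w : Fin n → ℝ, 0 < A.mulVec w ⬝ᵥ w)
    (M : ℝ) (hM : M = sSup {r : ℝ | ∃ x : Fin n → ℝ, x ⬝ᵥ u = 1 ∧ r = A.mulVec x ⬝ᵥ x})
    (z : Fin n → ℝ) (hz : z ⬝ᵥ u = 1) (hzM : A.mulVec z ⬝ᵥ z = M)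
    (C : Matrix (Fin n) (Fin n) ℝ) (hC : C = M • vecMulVec u u - A) :
    (∀ x : Fin n → ℝ, 0 ≤ C.mulVec x ⬝ᵥ x) ∧
    (∀ x : Fin n → ℝ, C.mulVec x = 0 ↔ ∃ c : ℝ, x = c • z) := by
  obtain ⟨p, hp, hpF⟩ := exists_dotProduct_eq_one_and_orthogonal u A hA hstrict z hz
  have hsplit (x : Fin n → ℝ) (hx : x ⬝ᵥ u = 1) :
      A *ᵥ x ⬝ᵥ x = A *ᵥ p ⬝ᵥ p + A *ᵥ (x - p) ⬝ᵥ (x - p) := by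
    have h := mulVec_dotProduct_smul_add_self A hA p (x - p)
      (hpF _ (by rw [sub_dotProduct, hx, hp, sub_self])) 1
    simpa using h
  have hpM : A *ᵥ p ⬝ᵥ p ≤ M := by
    rw [hM]
    refine le_csSup ⟨A *ᵥ p ⬝ᵥ p, ?_⟩ ⟨p, hp, rfl⟩
    rintro r ⟨x, hx, rfl⟩
    have := hneg (x - p) (by rw [sub_dotProduct, hx, hp, sub_self])
    linarith [hsplit x hx]
  have hzp : z - p = 0 := by
    have hu0 : (z - p) ⬝ᵥ u = 0 := by rw [sub_dotProduct, hz, hp, sub_self]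
    exact hstrict _ hu0 (le_antisymm (hneg _ hu0) (by linarith [hsplit z hz]))
  obtain rfl : z = p := sub_eq_zero.1 hzp
  have hCx (x : Fin n → ℝ) : C *ᵥ x = (M * (x ⬝ᵥ u)) • u - A *ᵥ x := by
    ext i
    simp [hC, sub_mulVec, smul_mulVec, vecMulVec_mulVec, dotProduct_comm u x]
    ring
  have hperp (x : Fin n → ℝ) : (x - (x ⬝ᵥ u) • z) ⬝ᵥ u = 0 := by
    simp [sub_dotProduct, smul_dotProduct, hz]
  have hAz : A *ᵥ z = M • u := by
    refine dotProduct_eq _ _ fun x ↦ ?_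
    have h := hpF _ (hperp x)
    rw [dotProduct_sub, dotProduct_smul, hzM, smul_eq_mul] at h
    rw [smul_dotProduct, smul_eq_mul, dotProduct_comm u x]
    linarith
  have hform (x : Fin n → ℝ) : C *ᵥ x ⬝ᵥ x =
      -(A *ᵥ (x - (x ⬝ᵥ u) • z) ⬝ᵥ (x - (x ⬝ᵥ u) • z)) := by
    have h := mulVec_dotProduct_smul_add_self A hA z _ (hpF _ (hperp x)) (x ⬝ᵥ u)
    rw [add_sub_cancel, hzM] at h
    rw [hCx, sub_dotProduct, smul_dotProduct, smul_eq_mul, dotProduct_comm u x, h]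
    ring
  refine ⟨fun x ↦ ?_, fun x ↦ ⟨fun hx ↦ ⟨x ⬝ᵥ u, ?_⟩, ?_⟩⟩
  · rw [hform, neg_nonneg]
    exact hneg _ (hperp x)
  · have h := hform x
    rw [hx, zero_dotProduct, eq_comm, neg_eq_zero] at h
    exact sub_eq_zero.1 (hstrict _ (hperp x) h)
  · rintro ⟨c, rfl⟩
    rw [mulVec_smul, hCx, hz, mul_one, hAz, sub_self, smul_zero]
end

section
/- Let u ≠ 0 in ℝⁿ and F = {x ∈ ℝⁿ : ⟨x,u⟩ = 0}. The dual norm on F of the restriction of the ℓ¹-norm to F (duality taken via the canonical inner product on F) is given by ‖x‖₁* = o(x) for all x ∈ F, where o(x) = max( max_{i,j ∈ supp u} |uᵢxⱼ − uⱼxᵢ|/(|uᵢ|+|uⱼ|), max_{i ∉ supp u} |xᵢ| ) is the oscillation of x with respect to u. -/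
open Matrix

/-- The oscillation of `x` with respect to `u`:
`o(x) = max( max_{i,j ∈ supp u} |uᵢxⱼ − uⱼxᵢ|/(|uᵢ|+|uⱼ|), max_{i ∉ supp u} |xᵢ| )`. -/
noncomputable def osc {n : ℕ} (u x : Fin n → ℝ) : ℝ :=
  sSup ({r : ℝ | ∃ i j, u i ≠ 0 ∧ u j ≠ 0 ∧ r = |u i * x j - u j * x i| / (|u i| + |u j|)} ∪
        {r : ℝ | ∃ i, u i = 0 ∧ r = |x i|})

/-- One-dimensional Helly argument: the intervals `{t | |x i - t * u i| ≤ M}` share a point as soon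
as they meet pairwise. -/
theorem exists_forall_abs_sub_mul_le {ι : Type*} [Fintype ι] {u x : ι → ℝ} {M : ℝ} (hu : u ≠ 0)
    (h : ∀ i j, u i ≠ 0 → u j ≠ 0 → |u i * x j - u j * x i| / (|u i| + |u j|) ≤ M)
    (h0 : ∀ i, u i = 0 → |x i| ≤ M) : ∃ t : ℝ, ∀ i, |x i - t * u i| ≤ M := by
  classical
  obtain ⟨k, hk⟩ := Function.ne_iff.1 hu
  obtain ⟨m, hm, hmax⟩ := Finset.exists_max_image (Finset.univ.filter fun i => u i ≠ 0)
    (fun i => x i / u i - M / |u i|) ⟨k, by simpa using hk⟩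
  simp only [Finset.mem_filter, Finset.mem_univ, true_and] at hm hmax
  refine ⟨x m / u m - M / |u m|, fun i => ?_⟩
  by_cases hi : u i = 0
  · simpa [hi] using h0 i hi
  have pi : 0 < |u i| := abs_pos.2 hi
  have pm : 0 < |u m| := abs_pos.2 hm
  have hlow := hmax i hi
  have hpair : x m / u m - x i / u i ≤ M / |u i| + M / |u m| := by
    have hM := (div_le_iff₀ (by positivity)).1 (h i m hi hm)
    have hsub : x m / u m - x i / u i = (u i * x m - u m * x i) / (u i * u m) := by
      field_simp
    have hadd : M / |u i| + M / |u m| = M * (|u i| + |u m|) / (|u i| * |u m|) := by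
      field_simp
      ring
    rw [hsub, hadd]
    refine (le_abs_self _).trans ?_
    rw [abs_div, abs_mul (u i)]
    gcongr
  set t := x m / u m - M / |u m| with ht
  have hfac : x i - t * u i = (x i / u i - t) * u i := by field_simp
  rw [hfac, abs_mul, ← le_div_iff₀ pi, abs_le]
  constructor <;> linarith

/-- A uniform bound on a translate of `x` along `u` bounds the pairing of `x` with the `ℓ¹` unit
ball of the orthogonal complement of `u`. -/
theorem abs_dotProduct_le_of_abs_sub_mul_le {ι : Type*} [Fintype ι] {u x y : ι → ℝ} {M t : ℝ}
    (hM : 0 ≤ M) (ht : ∀ i, |x i - t * u i| ≤ M) (hy : y ⬝ᵥ u = 0) (hy1 : ∑ i, |y i| ≤ 1) :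
    |x ⬝ᵥ y| ≤ M := by
  have hshift : x ⬝ᵥ y = ∑ i, (x i - t * u i) * y i := by
    have hsum : ∑ i, t * u i * y i = t * (y ⬝ᵥ u) := by
      rw [dotProduct, Finset.mul_sum]
      exact Finset.sum_congr rfl fun i _ => by ring
    simp only [sub_mul, Finset.sum_sub_distrib, hsum, hy]
    simp [dotProduct]
  calc |x ⬝ᵥ y| ≤ ∑ i, |(x i - t * u i) * y i| := hshift ▸ Finset.abs_sum_le_sum_abs _ _
    _ ≤ ∑ i, M * |y i| := Finset.sum_le_sum fun i _ => by
        rw [abs_mul]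
        exact mul_le_mul_of_nonneg_right (ht i) (abs_nonneg _)
    _ = M * ∑ i, |y i| := (Finset.mul_sum _ _ _).symm
    _ ≤ M := mul_le_of_le_one_right hM hy1

/-- The quotient `|uᵢxⱼ - uⱼxᵢ| / (|uᵢ| + |uⱼ|)` is attained on the `ℓ¹` unit ball of the
orthogonal complement of `u`. -/
theorem exists_abs_dotProduct_eq_div {ι : Type*} [Fintype ι] (u x : ι → ℝ) {i j : ι}
    (hi : u i ≠ 0) : ∃ y : ι → ℝ, y ⬝ᵥ u = 0 ∧ ∑ k, |y k| ≤ 1 ∧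
      |u i * x j - u j * x i| / (|u i| + |u j|) = |x ⬝ᵥ y| := by
  classical
  have hpos : 0 < |u i| + |u j| := add_pos_of_pos_of_nonneg (abs_pos.2 hi) (abs_nonneg _)
  refine ⟨(|u i| + |u j|)⁻¹ • (Pi.single j (u i) - Pi.single i (u j)), ?_, ?_, ?_⟩
  · simp [smul_dotProduct, sub_dotProduct, mul_comm]
  · have hterm : ∀ k, |((|u i| + |u j|)⁻¹ • (Pi.single j (u i) - Pi.single i (u j)) : ι → ℝ) k| ≤
        (|u i| + |u j|)⁻¹ *
          ((Pi.single j |u i| : ι → ℝ) k + (Pi.single i |u j| : ι → ℝ) k) := by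
      intro k
      rw [Pi.smul_apply, smul_eq_mul, abs_mul, abs_of_pos (inv_pos.2 hpos), Pi.sub_apply]
      refine mul_le_mul_of_nonneg_left ((abs_sub _ _).trans (le_of_eq ?_)) (inv_pos.2 hpos).le
      simp only [Pi.single_apply, apply_ite abs, abs_zero]
    refine (Finset.sum_le_sum fun k _ => hterm k).trans (le_of_eq ?_)
    rw [← Finset.mul_sum, Finset.sum_add_distrib]
    simp [inv_mul_cancel₀ hpos.ne']
  · rw [dotProduct_smul, dotProduct_sub, dotProduct_single, dotProduct_single, smul_eq_mul,
      abs_mul, abs_of_pos (inv_pos.2 hpos), div_eq_inv_mul, mul_comm (x j), mul_comm (x i)]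

/-- For `u ≠ 0` and `F = {x : ⟨x,u⟩ = 0}`, the dual norm on `F` of the
restriction of the `ℓ¹`-norm to `F` is the oscillation: `‖x‖₁* = o(x)` for all `x ∈ F`. -/
theorem dual_l1_norm_eq_osc {n : ℕ} (u : Fin n → ℝ) (hu : u ≠ 0)
    (x : Fin n → ℝ) (hx : x ⬝ᵥ u = 0) :
    sSup {r : ℝ | ∃ y : Fin n → ℝ, y ⬝ᵥ u = 0 ∧ (∑ i, |y i|) ≤ 1 ∧ r = |x ⬝ᵥ y|} = osc u x := by
  obtain ⟨k, hk⟩ := Function.ne_iff.1 hu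
  have hbdd : BddAbove
      ({r : ℝ | ∃ i j, u i ≠ 0 ∧ u j ≠ 0 ∧ r = |u i * x j - u j * x i| / (|u i| + |u j|)} ∪
        {r : ℝ | ∃ i, u i = 0 ∧ r = |x i|}) := by
    refine (Set.Finite.subset ((Set.finite_range fun p : Fin n × Fin n =>
      |u p.1 * x p.2 - u p.2 * x p.1| / (|u p.1| + |u p.2|)).union
      (Set.finite_range fun i => |x i|)) ?_).bddAbove
    rintro r (⟨i, j, -, -, rfl⟩ | ⟨i, -, rfl⟩)
    · exact Or.inl ⟨(i, j), rfl⟩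
    · exact Or.inr ⟨i, rfl⟩
  obtain ⟨t, ht⟩ := exists_forall_abs_sub_mul_le (M := osc u x) hu
    (fun i j hi hj => le_csSup hbdd (Or.inl ⟨i, j, hi, hj, rfl⟩))
    (fun i hi => le_csSup hbdd (Or.inr ⟨i, hi, rfl⟩))
  have hle : ∀ r ∈ {r : ℝ | ∃ y : Fin n → ℝ, y ⬝ᵥ u = 0 ∧ (∑ i, |y i|) ≤ 1 ∧ r = |x ⬝ᵥ y|},
      r ≤ osc u x := by
    rintro r ⟨y, hy, hy1, rfl⟩
    exact abs_dotProduct_le_of_abs_sub_mul_le ((abs_nonneg _).trans (ht k)) ht hy hy1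
  refine le_antisymm (csSup_le ⟨_, 0, by simp, by simp, rfl⟩ hle)
    (csSup_le_csSup ⟨_, hle⟩ ⟨_, Or.inl ⟨k, k, hk, hk, rfl⟩⟩ ?_)
  rintro r (⟨i, j, hi, -, rfl⟩ | ⟨i, hi, rfl⟩)
  · exact exists_abs_dotProduct_eq_div u x hi
  · refine ⟨Pi.single i 1, by simp [hi], ?_, by simp⟩
    simp [Pi.single_apply, apply_ite abs]
end

section
/- Let u ≠ 0 in ℝⁿ, F = {x ∈ ℝⁿ : ⟨x,u⟩ = 0}, F₁ = {x ∈ ℝⁿ : ⟨x,u⟩ = 1}, and let A be a real symmetric n×n matrix of strict negative type on F but not of negative type on ℝⁿ. Let M = sup_{x ∈ F₁} ⟨Ax,x⟩, let z ∈ F₁ be the unique element with ⟨Az,z⟩ = M, and set B = (1/M)·z·zᵀ − A⁻¹. Then the dual norm on F of the norm ‖x‖₋ₐ = ⟨−Ax,x⟩^{1/2} is given by ‖x‖₋ₐ* = ‖x‖_B = ⟨Bx,x⟩^{1/2} for all x ∈ F. -/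
open Matrix

namespace Matrix

variable {ι : Type*} [Fintype ι]

theorem IsSymm.mulVec_dotProduct_comm_s7 {A : Matrix ι ι ℝ} (hA : A.IsSymm) (a b : ι → ℝ) :
    A.mulVec a ⬝ᵥ b = A.mulVec b ⬝ᵥ a := by
  rw [dotProduct_comm, dotProduct_mulVec, ← mulVec_transpose, hA.eq]

theorem IsSymm.mulVec_add_smul_dotProduct_self {A : Matrix ι ι ℝ} (hA : A.IsSymm)
    (a b : ι → ℝ) (t : ℝ) :
    A.mulVec (a + t • b) ⬝ᵥ (a + t • b) =
      A.mulVec a ⬝ᵥ a + 2 * t * (A.mulVec a ⬝ᵥ b) + t ^ 2 * (A.mulVec b ⬝ᵥ b) := by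
  simp only [mulVec_add, mulVec_smul, add_dotProduct, dotProduct_add, smul_dotProduct,
    dotProduct_smul, smul_eq_mul, hA.mulVec_dotProduct_comm_s7 b a]
  ring

/-- A symmetric matrix of strict negative type on the hyperplane `u⊥` but not of negative type
on the whole space is nonsingular. -/
theorem IsSymm.isUnit_det_of_strict_neg_on_hyperplane [DecidableEq ι] {A : Matrix ι ι ℝ}
    (hA : A.IsSymm) {u : ι → ℝ} (hneg : ∀ x : ι → ℝ, x ⬝ᵥ u = 0 → A.mulVec x ⬝ᵥ x ≤ 0)
    (hstrict : ∀ x : ι → ℝ, x ⬝ᵥ u = 0 → A.mulVec x ⬝ᵥ x = 0 → x = 0)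
    (hnot : ∃ w : ι → ℝ, 0 < A.mulVec w ⬝ᵥ w) : IsUnit A.det := by
  rw [isUnit_iff_ne_zero]
  intro hdet
  obtain ⟨v, hv0, hv⟩ := exists_mulVec_eq_zero_iff.mpr hdet
  by_cases hvu : v ⬝ᵥ u = 0
  · exact hv0 (hstrict v hvu (by rw [hv, zero_dotProduct]))
  obtain ⟨w, hw⟩ := hnot
  have hmem : (w + (-(w ⬝ᵥ u / v ⬝ᵥ u)) • v) ⬝ᵥ u = 0 := by
    rw [add_dotProduct, smul_dotProduct, smul_eq_mul]
    field_simp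
    ring
  have := hneg _ hmem
  rw [hA.mulVec_add_smul_dotProduct_self, hA.mulVec_dotProduct_comm_s7 w v, hv] at this
  simp only [zero_dotProduct, mul_zero, add_zero] at this
  linarith

/-- A maximizer `z` of the quadratic form of `A` on the affine hyperplane `⟨x, u⟩ = 1` satisfies
the Lagrange condition `A z = M u`, with nonzero multiplier the maximal value `M`. -/
theorem IsSymm.mulVec_eq_smul_of_eq_sSup [DecidableEq ι] {A : Matrix ι ι ℝ}
    (hA : A.IsSymm) {u : ι → ℝ} (hu : u ≠ 0)
    (hneg : ∀ x : ι → ℝ, x ⬝ᵥ u = 0 → A.mulVec x ⬝ᵥ x ≤ 0)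
    (hstrict : ∀ x : ι → ℝ, x ⬝ᵥ u = 0 → A.mulVec x ⬝ᵥ x = 0 → x = 0)
    (hdet : IsUnit A.det) {M : ℝ}
    (hM : M = sSup {r : ℝ | ∃ x : ι → ℝ, x ⬝ᵥ u = 1 ∧ r = A.mulVec x ⬝ᵥ x})
    {z : ι → ℝ} (hz : z ⬝ᵥ u = 1) (hzM : A.mulVec z ⬝ᵥ z = M) :
    M ≠ 0 ∧ A.mulVec z = M • u := by
  obtain ⟨v, hv⟩ : ∃ v, A.mulVec v = u :=
    ⟨A⁻¹.mulVec u, by rw [mulVec_mulVec, mul_nonsing_inv _ hdet, one_mulVec]⟩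
  have hvu : v ⬝ᵥ u ≠ 0 := by
    intro h
    have hv0 := hstrict v h (by rw [hv, dotProduct_comm, h])
    exact hu (by rw [← hv, hv0, mulVec_zero])
  set m : ℝ := (v ⬝ᵥ u)⁻¹ with hm
  have hmu : (m • v) ⬝ᵥ u = 1 := by
    rw [smul_dotProduct, smul_eq_mul, hm, inv_mul_cancel₀ hvu]
  have hAm : A.mulVec (m • v) = m • u := by rw [mulVec_smul, hv]
  have hval (x : ι → ℝ) (hx : x ⬝ᵥ u = 1) : (x - m • v) ⬝ᵥ u = 0 ∧
      A.mulVec x ⬝ᵥ x = m + A.mulVec (x - m • v) ⬝ᵥ (x - m • v) := by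
    have hsub : (x - m • v) ⬝ᵥ u = 0 := by rw [sub_dotProduct, hx, hmu, sub_self]
    refine ⟨hsub, ?_⟩
    have h := hA.mulVec_add_smul_dotProduct_self (m • v) (x - m • v) 1
    rw [one_smul, add_sub_cancel, hAm, smul_dotProduct, smul_dotProduct,
      dotProduct_comm u (x - m • v), hsub, dotProduct_comm u (m • v), hmu] at h
    simpa using h
  have hMm : M = m := by
    rw [hM]
    refine IsGreatest.csSup_eq ⟨⟨m • v, hmu, ?_⟩, ?_⟩
    · rw [hAm, smul_dotProduct, dotProduct_comm, hmu, smul_eq_mul, mul_one]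
    · rintro r ⟨x, hx, rfl⟩
      obtain ⟨hsub, h⟩ := hval x hx
      linarith [hneg _ hsub]
  obtain ⟨hsub, h⟩ := hval z hz
  have hzv : z = m • v := sub_eq_zero.mp (hstrict _ hsub (by linarith))
  exact ⟨hMm ▸ inv_ne_zero hvu, by rw [hzv, hAm, hMm]⟩

/-- The dual norm, on the hyperplane `u⊥`, of the functional represented by `p` in the
positive semidefinite form `-A`. -/
theorem IsSymm.isGreatest_abs_dotProduct_of_neg_on_hyperplane {A : Matrix ι ι ℝ} (hA : A.IsSymm)
    {u : ι → ℝ} (hneg : ∀ x : ι → ℝ, x ⬝ᵥ u = 0 → A.mulVec x ⬝ᵥ x ≤ 0)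
    {x p : ι → ℝ} (hp : p ⬝ᵥ u = 0)
    (hxp : ∀ y : ι → ℝ, y ⬝ᵥ u = 0 → x ⬝ᵥ y = -(A.mulVec p ⬝ᵥ y)) :
    IsGreatest {r : ℝ | ∃ y : ι → ℝ, y ⬝ᵥ u = 0 ∧
      Real.sqrt (-(A.mulVec y ⬝ᵥ y)) ≤ 1 ∧ r = |x ⬝ᵥ y|} (Real.sqrt (x ⬝ᵥ p)) := by
  have hq : 0 ≤ x ⬝ᵥ p := by linarith [hneg p hp, hxp p hp]
  constructor
  · rcases hq.eq_or_lt with h0 | hpos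
    · exact ⟨0, by simp, by simp, by simp [← h0]⟩
    · have hs := Real.sq_sqrt hq
      have hs0 := Real.sqrt_pos.mpr hpos
      refine ⟨(Real.sqrt (x ⬝ᵥ p))⁻¹ • p, by rw [smul_dotProduct, hp, smul_zero], ?_, ?_⟩
      · refine Real.sqrt_le_iff.mpr ⟨zero_le_one, ?_⟩
        rw [mulVec_smul, smul_dotProduct, dotProduct_smul, smul_eq_mul, smul_eq_mul,
          ← mul_neg, ← mul_neg, ← hxp p hp]
        field_simp
        exact hs.ge
      · rw [dotProduct_smul, smul_eq_mul, abs_of_nonneg (by positivity)]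
        field_simp
        exact hs
  · rintro r ⟨y, hy, hy1, rfl⟩
    replace hy1 := (Real.sqrt_le_iff.mp hy1).2
    rw [one_pow] at hy1
    refine Real.abs_le_sqrt ?_
    have hmem : (p + (-(x ⬝ᵥ y)) • y) ⬝ᵥ u = 0 := by
      rw [add_dotProduct, smul_dotProduct, hp, hy, smul_zero, add_zero]
    have h := hneg _ hmem
    rw [hA.mulVec_add_smul_dotProduct_self, ← neg_eq_iff_eq_neg.mpr (hxp y hy),
      ← neg_eq_iff_eq_neg.mpr (hxp p hp)] at h
    nlinarith [mul_le_mul_of_nonneg_left hy1 (sq_nonneg (x ⬝ᵥ y))]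

end Matrix

/-- With `M = sup_{x ∈ F₁} ⟨Ax,x⟩`, `z ∈ F₁` the unique maximal element and
`B = (1/M)·zzᵀ − A⁻¹`, the dual norm on `F` of the norm `‖x‖₋ₐ = ⟨−Ax,x⟩^{1/2}` is given by
`‖x‖₋ₐ* = ‖x‖_B = ⟨Bx,x⟩^{1/2}` for all `x ∈ F`. -/
theorem dual_negA_norm_eq_B {n : ℕ} (u : Fin n → ℝ) (hu : u ≠ 0)
    (A : Matrix (Fin n) (Fin n) ℝ) (hA : A.IsSymm)
    (hneg : ∀ x : Fin n → ℝ, x ⬝ᵥ u = 0 → A.mulVec x ⬝ᵥ x ≤ 0)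
    (hstrict : ∀ x : Fin n → ℝ, x ⬝ᵥ u = 0 → A.mulVec x ⬝ᵥ x = 0 → x = 0)
    (hnot : ∃ w : Fin n → ℝ, 0 < A.mulVec w ⬝ᵥ w)
    (M : ℝ) (hM : M = sSup {r : ℝ | ∃ x : Fin n → ℝ, x ⬝ᵥ u = 1 ∧ r = A.mulVec x ⬝ᵥ x})
    (z : Fin n → ℝ) (hz : z ⬝ᵥ u = 1) (hzM : A.mulVec z ⬝ᵥ z = M)
    (B : Matrix (Fin n) (Fin n) ℝ) (hB : B = (1 / M) • vecMulVec z z - A⁻¹)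
    (x : Fin n → ℝ) (hx : x ⬝ᵥ u = 0) :
    sSup {r : ℝ | ∃ y : Fin n → ℝ, y ⬝ᵥ u = 0 ∧
        Real.sqrt (-(A.mulVec y ⬝ᵥ y)) ≤ 1 ∧ r = |x ⬝ᵥ y|}
      = Real.sqrt (B.mulVec x ⬝ᵥ x) := by
  have hdet := hA.isUnit_det_of_strict_neg_on_hyperplane hneg hstrict hnot
  obtain ⟨hM0, hAz⟩ := hA.mulVec_eq_smul_of_eq_sSup hu hneg hstrict hdet hM hz hzM
  have hBx : B.mulVec x = (z ⬝ᵥ x / M) • z - A⁻¹.mulVec x := by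
    rw [hB, sub_mulVec, smul_mulVec, vecMulVec_mulVec, op_smul_eq_smul, smul_smul,
      one_div_mul_eq_div]
  have hAinv : A.mulVec (A⁻¹.mulVec x) = x := by
    rw [mulVec_mulVec, mul_nonsing_inv _ hdet, one_mulVec]
  have hABx : A.mulVec (B.mulVec x) = (z ⬝ᵥ x) • u - x := by
    rw [hBx, mulVec_sub, mulVec_smul, hAz, hAinv, smul_smul, div_mul_cancel₀ _ hM0]
  have hBxu : B.mulVec x ⬝ᵥ u = 0 := by
    have h := hA.mulVec_dotProduct_comm_s7 (B.mulVec x) z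
    rw [hABx, hAz, sub_dotProduct, smul_dotProduct, smul_dotProduct, dotProduct_comm u z, hz,
      dotProduct_comm x z, smul_eq_mul, mul_one, sub_self, smul_eq_mul, dotProduct_comm] at h
    exact (mul_eq_zero.mp h.symm).resolve_left hM0
  rw [dotProduct_comm (B.mulVec x) x]
  refine (hA.isGreatest_abs_dotProduct_of_neg_on_hyperplane hneg hBxu fun y hy => ?_).csSup_eq
  rw [hABx, sub_dotProduct, smul_dotProduct, dotProduct_comm u y, hy, smul_zero, zero_sub, neg_neg]
end

section
/- Let u ≠ 0 in ℝⁿ and F = {x ∈ ℝⁿ : ⟨x,u⟩ = 0}. Then the unit ball of the dual norm of the ℓ¹-norm on F satisfies {x ∈ F : ‖x‖₁* ≤ 1} = conv E, where E = { x − (⟨x,u⟩/‖u‖₂²)·u : x ∈ {−1,1}ⁿ }. -/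
open Matrix

/-- Hölder's inequality for the pairing of `ℓ^∞` and `ℓ¹`. -/
theorem abs_dotProduct_le_mul_sum_abs {ι : Type*} [Fintype ι] {c : ι → ℝ} {M : ℝ}
    (hc : ∀ i, |c i| ≤ M) (y : ι → ℝ) : |c ⬝ᵥ y| ≤ M * ∑ i, |y i| := by
  rw [dotProduct, Finset.mul_sum]
  refine (Finset.abs_sum_le_sum_abs _ _).trans (Finset.sum_le_sum fun i _ => ?_)
  rw [abs_mul]
  exact mul_le_mul_of_nonneg_right (hc i) (abs_nonneg _)

/-- The projection along `u` of the convex hull of the sign vectors is the projection of the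
cube `[-1, 1]ⁿ`. -/
theorem mem_convexHull_proj_signs_iff {ι : Type*} [Fintype ι] (u x : ι → ℝ) :
    x ∈ convexHull ℝ {v : ι → ℝ | ∃ s : ι → ℝ, (∀ i, s i = 1 ∨ s i = -1) ∧
      v = s - ((s ⬝ᵥ u) / (∑ i, (u i) ^ 2)) • u} ↔
    ∃ c : ι → ℝ, (∀ i, |c i| ≤ 1) ∧ x = c - ((c ⬝ᵥ u) / (∑ i, (u i) ^ 2)) • u := by
  let P : (ι → ℝ) →ₗ[ℝ] (ι → ℝ) :=
    { toFun := fun c => c - ((c ⬝ᵥ u) / (∑ i, (u i) ^ 2)) • u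
      map_add' := fun a b => by
        ext i
        simp only [add_dotProduct, Pi.sub_apply, Pi.add_apply, Pi.smul_apply, smul_eq_mul]
        ring
      map_smul' := fun r a => by
        ext i
        simp only [smul_dotProduct, Pi.sub_apply, Pi.smul_apply, smul_eq_mul, RingHom.id_apply]
        ring }
  have hE : {v : ι → ℝ | ∃ s : ι → ℝ, (∀ i, s i = 1 ∨ s i = -1) ∧
      v = s - ((s ⬝ᵥ u) / (∑ i, (u i) ^ 2)) • u} =
      P '' (Set.univ.pi fun _ => ({1, -1} : Set ℝ)) := by
    ext v
    simp [P, eq_comm]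
  rw [hE, ← P.image_convexHull, convexHull_pi]
  simp only [Set.mem_image, Set.mem_univ_pi, convexHull_pair, segment_symm ℝ (1 : ℝ) (-1),
    segment_eq_Icc (show (-1 : ℝ) ≤ 1 by norm_num), Set.mem_Icc, ← abs_le]
  exact exists_congr fun c => and_congr_right fun _ => eq_comm

/-- If `x` has dual `ℓ¹`-norm at most one on the hyperplane orthogonal to `u`, then some translate
of `x` along `u` lies in the cube `[-1, 1]ⁿ`. -/
theorem exists_abs_add_mul_le_one {ι : Type*} [Fintype ι] {u x : ι → ℝ} (hu : u ≠ 0)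
    (h : ∀ y : ι → ℝ, y ⬝ᵥ u = 0 → |x ⬝ᵥ y| ≤ ∑ i, |y i|) :
    ∃ t : ℝ, ∀ i, |x i + t * u i| ≤ 1 := by
  classical
  have hsum (i : ι) (a : ℝ) : ∑ k, |(Pi.single i a : ι → ℝ) k| = |a| := by
    rw [Finset.sum_eq_single i] <;> simp +contextual
  have hpair (i j : ι) : |x i * u j - x j * u i| ≤ |u j| + |u i| := by
    have hy := h (Pi.single i (u j) - Pi.single j (u i)) (by
      rw [sub_dotProduct, single_dotProduct, single_dotProduct]; ring)
    rw [dotProduct_sub, dotProduct_single, dotProduct_single] at hy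
    refine hy.trans ?_
    rw [← hsum i (u j), ← hsum j (u i), ← Finset.sum_add_distrib]
    exact Finset.sum_le_sum fun k _ => abs_sub _ _
  obtain ⟨k, hk⟩ := Function.ne_iff.mp hu
  obtain ⟨m, hm, hmax⟩ := (Finset.univ.filter fun i => u i ≠ 0).exists_max_image
    (fun i => -(x i / u i) - 1 / |u i|) ⟨k, by simpa using hk⟩
  have hm : u m ≠ 0 := by simpa using hm
  refine ⟨-(x m / u m) - 1 / |u m|, fun i => ?_⟩
  by_cases hi : u i = 0
  · have hy := h (Pi.single i 1) (by simp [hi])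
    rw [hsum] at hy
    simpa [hi] using hy
  have hlow := hmax i (by simpa using hi)
  have hup : |x m / u m - x i / u i| ≤ 1 / |u m| + 1 / |u i| := by
    have hmi : 0 < |u m| * |u i| := by positivity
    have e₁ : x m / u m - x i / u i = (x m * u i - x i * u m) / (u m * u i) := by
      field_simp
    have e₂ : 1 / |u m| + 1 / |u i| = (|u i| + |u m|) / (|u m| * |u i|) := by
      field_simp
    rw [e₁, e₂, abs_div, abs_mul]
    exact div_le_div_of_nonneg_right (hpair m i) hmi.le
  have hfac : x i + (-(x m / u m) - 1 / |u m|) * u i =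
      (x i / u i + (-(x m / u m) - 1 / |u m|)) * u i := by
    field_simp
  rw [hfac, abs_mul, ← le_div_iff₀ (abs_pos.mpr hi), abs_le]
  have := abs_le.mp hup
  constructor <;> linarith

/-- A bound on the supremum defining the dual `ℓ¹`-norm bounds the pairing itself. -/
theorem abs_dotProduct_le_sum_abs_of_sSup_le_one {ι : Type*} [Fintype ι] {u x : ι → ℝ}
    (h : sSup {r : ℝ | ∃ y : ι → ℝ, y ⬝ᵥ u = 0 ∧ (∑ i, |y i|) ≤ 1 ∧ r = |x ⬝ᵥ y|} ≤ 1)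
    (y : ι → ℝ) (hy : y ⬝ᵥ u = 0) : |x ⬝ᵥ y| ≤ ∑ i, |y i| := by
  have hx (z : ι → ℝ) : |x ⬝ᵥ z| ≤ ‖x‖ * ∑ i, |z i| :=
    abs_dotProduct_le_mul_sum_abs (norm_le_pi_norm x) z
  have hbdd : BddAbove {r : ℝ | ∃ y : ι → ℝ, y ⬝ᵥ u = 0 ∧ (∑ i, |y i|) ≤ 1 ∧
      r = |x ⬝ᵥ y|} := by
    refine ⟨‖x‖, ?_⟩
    rintro _ ⟨z, -, hz, rfl⟩
    exact (hx z).trans (mul_le_of_le_one_right (norm_nonneg x) hz)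
  have hnonneg : 0 ≤ ∑ i, |y i| := Finset.sum_nonneg fun i _ => abs_nonneg _
  rcases hnonneg.eq_or_lt with h0 | hpos
  · simpa [← h0] using hx y
  have hle := (le_csSup hbdd ⟨(∑ i, |y i|)⁻¹ • y, by simp [hy], by
    simp only [Pi.smul_apply, smul_eq_mul, abs_mul, ← Finset.mul_sum, abs_inv,
      abs_of_pos hpos, inv_mul_cancel₀ hpos.ne', le_refl], rfl⟩).trans h
  rwa [dotProduct_smul, smul_eq_mul, abs_mul, abs_inv, abs_of_pos hpos,
    inv_mul_le_iff₀ hpos, mul_one] at hle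



/-- For `u ≠ 0` and `F = {x : ⟨x,u⟩ = 0}`, the unit ball of the dual norm of the
`ℓ¹`-norm on `F` equals `conv E` where `E = { x − (⟨x,u⟩/‖u‖₂²)·u : x ∈ {−1,1}ⁿ }`. -/
theorem dual_l1_unit_ball_eq_convexHull {n : ℕ} (u : Fin n → ℝ) (hu : u ≠ 0) :
    {x : Fin n → ℝ | x ⬝ᵥ u = 0 ∧
        sSup {r : ℝ | ∃ y : Fin n → ℝ, y ⬝ᵥ u = 0 ∧ (∑ i, |y i|) ≤ 1 ∧ r = |x ⬝ᵥ y|} ≤ 1}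
      = convexHull ℝ {v : Fin n → ℝ | ∃ s : Fin n → ℝ, (∀ i, s i = 1 ∨ s i = -1) ∧
          v = s - ((s ⬝ᵥ u) / (∑ i, (u i) ^ 2)) • u} := by
  have hS : ∑ i, (u i) ^ 2 = u ⬝ᵥ u := Finset.sum_congr rfl fun i _ => sq (u i)
  have hne : u ⬝ᵥ u ≠ 0 := fun h => hu (dotProduct_self_eq_zero.mp h)
  ext x
  rw [mem_convexHull_proj_signs_iff, hS]
  constructor
  · rintro ⟨hxu, hx⟩
    obtain ⟨t, ht⟩ := exists_abs_add_mul_le_one hu (abs_dotProduct_le_sum_abs_of_sSup_le_one hx)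
    refine ⟨x + t • u, ht, ?_⟩
    rw [add_dotProduct, hxu, smul_dotProduct, smul_eq_mul, zero_add, mul_div_cancel_right₀ _ hne,
      add_sub_cancel_right]
  · rintro ⟨c, hc, rfl⟩
    refine ⟨by rw [sub_dotProduct, smul_dotProduct, smul_eq_mul, div_mul_cancel₀ _ hne, sub_self],
      Real.sSup_le ?_ zero_le_one⟩
    rintro _ ⟨y, hy, hy1, rfl⟩
    rw [sub_dotProduct, smul_dotProduct, dotProduct_comm u y, hy, smul_zero, sub_zero]
    exact (abs_dotProduct_le_mul_sum_abs hc y).trans (by rwa [one_mul])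
end

section
/- Let u ≠ 0 in ℝⁿ, F = {x ∈ ℝⁿ : ⟨x,u⟩ = 0}, and let A be a real symmetric n×n matrix of strict negative type on F but not of negative type on ℝⁿ. Then the negative type gap Γ of A on F satisfies Γ = 2/β, where β = sup{ ⟨−Ax,x⟩ : x ∈ F, o(Ax) ≤ 1 } and o is the oscillation with respect to u. -/
open Matrix

/-- The set of admissible constants for the negative type gap of `A` on
`F = {x : ⟨x,u⟩ = 0}`. The gap `Γ` is the largest element, i.e. the supremum. -/
def gapSet {n : ℕ} (u : Fin n → ℝ) (A : Matrix (Fin n) (Fin n) ℝ) : Set ℝ :=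
  {G : ℝ | 0 ≤ G ∧ ∀ x : Fin n → ℝ, x ⬝ᵥ u = 0 →
    G / 2 * (∑ i, |x i|) ^ 2 + A.mulVec x ⬝ᵥ x ≤ 0}

theorem bddAbove_osc_set {n : ℕ} (u x : Fin n → ℝ) :
    BddAbove ({r : ℝ | ∃ i j, u i ≠ 0 ∧ u j ≠ 0 ∧
        r = |u i * x j - u j * x i| / (|u i| + |u j|)} ∪
      {r : ℝ | ∃ i, u i = 0 ∧ r = |x i|}) := by
  refine ((Set.finite_range fun p : Fin n × Fin n =>
    |u p.1 * x p.2 - u p.2 * x p.1| / (|u p.1| + |u p.2|)).union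
      (Set.finite_range fun i => |x i|)).bddAbove.mono (Set.union_subset_union ?_ ?_)
  · rintro r ⟨i, j, -, -, rfl⟩
    exact ⟨(i, j), rfl⟩
  · rintro r ⟨i, -, rfl⟩
    exact ⟨i, rfl⟩

/-- A one-dimensional Helly argument: the oscillation is the sup-norm distance to the line
spanned by `u`. -/
theorem exists_abs_sub_mul_le_of_osc_le {n : ℕ} {u x : Fin n → ℝ} (hu : u ≠ 0) {r : ℝ}
    (h : osc u x ≤ r) : ∃ t : ℝ, ∀ i, |x i - t * u i| ≤ r := by
  have hpair : ∀ i j, u i ≠ 0 → u j ≠ 0 →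
      |u i * x j - u j * x i| ≤ r * (|u i| + |u j|) := by
    intro i j hi hj
    have hpos : 0 < |u i| + |u j| := add_pos (abs_pos.2 hi) (abs_pos.2 hj)
    rw [← div_le_iff₀ hpos]
    exact (le_csSup (bddAbove_osc_set u x) (Or.inl ⟨i, j, hi, hj, rfl⟩)).trans h
  obtain ⟨k₀, hk₀⟩ := Function.ne_iff.1 hu
  obtain ⟨k, hk, hmax⟩ := Finset.exists_max_image (Finset.univ.filter fun i => u i ≠ 0)
    (fun i => x i / u i - r / |u i|) ⟨k₀, by simpa using hk₀⟩
  simp only [Finset.mem_filter, Finset.mem_univ, true_and] at hk hmax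
  refine ⟨x k / u k - r / |u k|, fun i => ?_⟩
  by_cases hi : u i = 0
  · simpa [hi] using (le_csSup (bddAbove_osc_set u x) (Or.inr ⟨i, hi, rfl⟩)).trans h
  have hi' := abs_pos.2 hi
  have hk' := abs_pos.2 hk
  have hlow := hmax i hi
  have hup : x k / u k - r / |u k| ≤ x i / u i + r / |u i| := by
    have hdiff : |x k / u k - x i / u i| ≤ r / |u i| + r / |u k| := by
      have e : x k / u k - x i / u i = (u i * x k - u k * x i) / (u i * u k) := by
        field_simp
      rw [e, abs_div, abs_mul, div_le_iff₀ (mul_pos hi' hk')]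
      refine (hpair i k hi hk).trans_eq ?_
      field_simp
      ring
    linarith [le_abs_self (x k / u k - x i / u i)]
  have hx : x i - (x k / u k - r / |u k|) * u i
      = (x i / u i - (x k / u k - r / |u k|)) * u i := by
    rw [sub_mul (x i / u i), div_mul_cancel₀ _ hi]
  rw [hx, abs_mul, ← le_div_iff₀ hi', abs_le]
  constructor <;> linarith

theorem osc_le_of_abs_sub_mul_le {n : ℕ} {u x : Fin n → ℝ} {r t : ℝ} (hr : 0 ≤ r)
    (h : ∀ i, |x i - t * u i| ≤ r) : osc u x ≤ r := by
  refine Real.sSup_le ?_ hr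
  rintro _ (⟨i, j, hi, hj, rfl⟩ | ⟨i, hi, rfl⟩)
  · rw [div_le_iff₀ (add_pos (abs_pos.2 hi) (abs_pos.2 hj))]
    have e : u i * x j - u j * x i = u i * (x j - t * u j) - u j * (x i - t * u i) := by ring
    rw [e]
    refine (abs_sub _ _).trans ?_
    rw [abs_mul, abs_mul]
    nlinarith [mul_le_mul_of_nonneg_left (h j) (abs_nonneg (u i)),
      mul_le_mul_of_nonneg_left (h i) (abs_nonneg (u j))]
  · simpa [hi] using h i

theorem dotProduct_le_sum_abs_of_osc_le_one {n : ℕ} {u y z : Fin n → ℝ} (hu : u ≠ 0)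
    (hz : z ⬝ᵥ u = 0) (hy : osc u y ≤ 1) : |y ⬝ᵥ z| ≤ ∑ i, |z i| := by
  obtain ⟨t, ht⟩ := exists_abs_sub_mul_le_of_osc_le hu hy
  have e : y ⬝ᵥ z = ∑ i, (y i - t * u i) * z i := by
    have : y ⬝ᵥ z = (y - t • u) ⬝ᵥ z := by
      rw [sub_dotProduct, smul_dotProduct, dotProduct_comm u z, hz, smul_zero, sub_zero]
    rw [this]
    rfl
  rw [e]
  refine (Finset.abs_sum_le_sum_abs _ _).trans (Finset.sum_le_sum fun i _ => ?_)
  rw [abs_mul]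
  exact mul_le_of_le_one_left (abs_nonneg _) (ht i)

theorem exists_eq_smul_of_dotProduct_eq_zero {n : ℕ} {u v : Fin n → ℝ} (hu : u ≠ 0)
    (h : ∀ y : Fin n → ℝ, y ⬝ᵥ u = 0 → v ⬝ᵥ y = 0) : ∃ t : ℝ, v = t • u := by
  have huu : u ⬝ᵥ u ≠ 0 := fun h0 => hu (dotProduct_self_eq_zero.1 h0)
  refine ⟨v ⬝ᵥ u / (u ⬝ᵥ u), sub_eq_zero.1 (dotProduct_self_eq_zero.1 ?_)⟩
  have hw : (v - (v ⬝ᵥ u / (u ⬝ᵥ u)) • u) ⬝ᵥ u = 0 := by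
    rw [sub_dotProduct, smul_dotProduct, smul_eq_mul, div_mul_cancel₀ _ huu, sub_self]
  rw [sub_dotProduct, h _ hw, smul_dotProduct, dotProduct_comm u (_ - _), hw, smul_zero, sub_zero]

/-- Every linear functional on the hyperplane orthogonal to `u` is represented by the form of a
matrix that is anisotropic on that hyperplane. -/
theorem exists_mulVec_dotProduct_eq {n : ℕ} {u : Fin n → ℝ} {A : Matrix (Fin n) (Fin n) ℝ}
    (hA : ∀ x : Fin n → ℝ, x ⬝ᵥ u = 0 → A.mulVec x ⬝ᵥ x = 0 → x = 0) (s : Fin n → ℝ) :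
    ∃ x : Fin n → ℝ, x ⬝ᵥ u = 0 ∧
      ∀ y : Fin n → ℝ, y ⬝ᵥ u = 0 → A.mulVec x ⬝ᵥ y = s ⬝ᵥ y := by
  let F : Submodule ℝ (Fin n → ℝ) := LinearMap.ker (dotProductBilin ℝ ℝ u)
  have hF : ∀ x, x ∈ F ↔ x ⬝ᵥ u = 0 := fun x => by
    rw [dotProduct_comm]
    rfl
  let L : F →ₗ[ℝ] Module.Dual ℝ F :=
    (dotProductBilin ℝ ℝ).compl₁₂ (A.mulVecLin ∘ₗ F.subtype) F.subtype
  have hL : Function.Injective L := by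
    refine (injective_iff_map_eq_zero L).2 fun x hx => Subtype.ext ?_
    exact hA x ((hF _).1 x.2) (LinearMap.congr_fun hx x)
  obtain ⟨x, hx⟩ := (LinearMap.injective_iff_surjective_of_finrank_eq_finrank
    Subspace.dual_finrank_eq.symm).1 hL (dotProductBilin ℝ ℝ s ∘ₗ F.subtype)
  exact ⟨x, (hF _).1 x.2, fun y hy => LinearMap.congr_fun hx ⟨y, (hF y).2 hy⟩⟩

/-- Cauchy–Schwarz for a symmetric form that is nonpositive on a hyperplane. -/
theorem sq_mulVec_dotProduct_le {n : ℕ} {u : Fin n → ℝ} {A : Matrix (Fin n) (Fin n) ℝ}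
    (hA : A.IsSymm) (hneg : ∀ x : Fin n → ℝ, x ⬝ᵥ u = 0 → A.mulVec x ⬝ᵥ x ≤ 0)
    {x z : Fin n → ℝ} (hx : x ⬝ᵥ u = 0) (hz : z ⬝ᵥ u = 0) :
    (A.mulVec x ⬝ᵥ z) ^ 2 ≤ (A.mulVec x ⬝ᵥ x) * (A.mulVec z ⬝ᵥ z) := by
  have hsymm : A.mulVec z ⬝ᵥ x = A.mulVec x ⬝ᵥ z := by
    rw [dotProduct_comm, dotProduct_mulVec, ← mulVec_transpose, hA.eq]
  have key : ∀ c : ℝ, 0 ≤ (-(A.mulVec z ⬝ᵥ z)) * (c * c) + (-2 * (A.mulVec x ⬝ᵥ z)) * c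
      + -(A.mulVec x ⬝ᵥ x) := by
    intro c
    have h := hneg (x + c • z) (by
      rw [add_dotProduct, smul_dotProduct, hx, hz, smul_zero, add_zero])
    simp only [mulVec_add, mulVec_smul, add_dotProduct, dotProduct_add, smul_dotProduct,
      dotProduct_smul, smul_eq_mul, hsymm] at h
    linarith
  have := discrim_le_zero key
  unfold discrim at this
  linarith

theorem exists_osc_le_one_mulVec_dotProduct_eq_sum_abs {n : ℕ} {u : Fin n → ℝ} (hu : u ≠ 0)
    {A : Matrix (Fin n) (Fin n) ℝ}
    (hA : ∀ x : Fin n → ℝ, x ⬝ᵥ u = 0 → A.mulVec x ⬝ᵥ x = 0 → x = 0) {z : Fin n → ℝ}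
    (hz : z ⬝ᵥ u = 0) :
    ∃ x : Fin n → ℝ, x ⬝ᵥ u = 0 ∧ osc u (A.mulVec x) ≤ 1 ∧
      A.mulVec x ⬝ᵥ z = ∑ i, |z i| := by
  obtain ⟨x, hx, hxs⟩ := exists_mulVec_dotProduct_eq hA fun i => (SignType.sign (z i) : ℝ)
  obtain ⟨t, ht⟩ := exists_eq_smul_of_dotProduct_eq_zero hu
    (v := A.mulVec x - fun i => (SignType.sign (z i) : ℝ)) fun y hy => by
      rw [sub_dotProduct, hxs y hy, sub_self]
  refine ⟨x, hx, osc_le_of_abs_sub_mul_le (t := t) zero_le_one fun i => ?_, ?_⟩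
  · have hi : A.mulVec x i - (SignType.sign (z i) : ℝ) = t * u i := congrFun ht i
    rw [← hi, sub_sub_cancel]
    cases SignType.sign (z i) <;> simp
  · rw [hxs z hz]
    exact Finset.sum_congr rfl fun i _ => sign_mul_self (z i)

theorem mem_gapSet_iff {n : ℕ} {u : Fin n → ℝ} (hu : u ≠ 0)
    {A : Matrix (Fin n) (Fin n) ℝ} (hA : A.IsSymm)
    (hneg : ∀ x : Fin n → ℝ, x ⬝ᵥ u = 0 → A.mulVec x ⬝ᵥ x ≤ 0)
    (hstrict : ∀ x : Fin n → ℝ, x ⬝ᵥ u = 0 → A.mulVec x ⬝ᵥ x = 0 → x = 0) (G : ℝ) :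
    G ∈ gapSet u A ↔ 0 ≤ G ∧ ∀ x : Fin n → ℝ, x ⬝ᵥ u = 0 → osc u (A.mulVec x) ≤ 1 →
      G * -(A.mulVec x ⬝ᵥ x) ≤ 2 := by
  refine and_congr_right fun hG => ⟨fun h x hx ho => ?_, fun h z hz => ?_⟩
  · have hsq := sq_le_sq' (by linarith [neg_abs_le (A.mulVec x ⬝ᵥ x),
      dotProduct_le_sum_abs_of_osc_le_one hu hx ho]) ((le_abs_self _).trans
        (dotProduct_le_sum_abs_of_osc_le_one hu hx ho))
    rcases (hneg x hx).eq_or_lt with h0 | h0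
    · rw [h0]
      norm_num
    · have h1 := h x hx
      have h2 := mul_le_mul_of_nonneg_left hsq hG
      by_contra! hlt
      nlinarith [mul_lt_mul_of_neg_right hlt h0]
  · obtain ⟨x, hx, ho, hxz⟩ := exists_osc_le_one_mulVec_dotProduct_eq_sum_abs hu hstrict hz
    have hcs := sq_mulVec_dotProduct_le hA hneg hx hz
    rw [hxz] at hcs
    have h1 := mul_le_mul_of_nonneg_left hcs hG
    have h2 := mul_le_mul_of_nonneg_right (h x hx ho) (neg_nonneg.2 (hneg z hz))
    nlinarith

theorem sSup_setOf_forall_mul_le {S : Set ℝ} (hne : S.Nonempty) (hS : ∀ r ∈ S, 0 ≤ r) {c : ℝ}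
    (hc : 0 ≤ c) : sSup {G : ℝ | 0 ≤ G ∧ ∀ r ∈ S, G * r ≤ c} = c / sSup S := by
  by_cases hb : BddAbove S
  · rcases (Real.sSup_nonneg hS).eq_or_lt with h0 | h0
    · have hzero : ∀ r ∈ S, r = 0 := fun r hr =>
        le_antisymm (h0 ▸ le_csSup hb hr) (hS r hr)
      have e : {G : ℝ | 0 ≤ G ∧ ∀ r ∈ S, G * r ≤ c} = Set.Ici 0 := by
        ext G
        exact ⟨And.left, fun hG => ⟨hG, fun r hr => by rwa [hzero r hr, mul_zero]⟩⟩
      rw [e, ← h0, div_zero, Real.sSup_of_not_bddAbove (not_bddAbove_Ici 0)]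
    · have e : {G : ℝ | 0 ≤ G ∧ ∀ r ∈ S, G * r ≤ c} = Set.Icc 0 (c / sSup S) := by
        ext G
        refine and_congr_right fun hG => ?_
        rw [le_div_iff₀ h0]
        refine ⟨fun h => ?_, fun h r hr =>
          (mul_le_mul_of_nonneg_left (le_csSup hb hr) hG).trans h⟩
        rcases (show (0 : ℝ) ≤ G from hG).eq_or_lt with hG0 | hG0
        · rwa [← hG0, zero_mul]
        · rw [mul_comm, ← le_div_iff₀ hG0]
          exact csSup_le hne fun r hr => by
            rw [le_div_iff₀ hG0, mul_comm]
            exact h r hr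
      rw [e, csSup_Icc (div_nonneg hc h0.le)]
  · have e : {G : ℝ | 0 ≤ G ∧ ∀ r ∈ S, G * r ≤ c} = {0} := by
      ext G
      refine ⟨fun ⟨hG, h⟩ => ?_, ?_⟩
      · by_contra hG0
        have hpos : 0 < G := lt_of_le_of_ne hG (Ne.symm hG0)
        exact hb ⟨c / G, fun r hr => by
          rw [le_div_iff₀ hpos, mul_comm]
          exact h r hr⟩
      · rintro rfl
        exact ⟨le_rfl, fun r _ => by rwa [zero_mul]⟩
    rw [e, csSup_singleton, Real.sSup_of_not_bddAbove hb, div_zero]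

/-- For `A` symmetric of strict negative type on `F` and not of negative type on
`ℝⁿ`, the gap `Γ` of `A` on `F` equals `2/β` with
`β = sup{ ⟨−Ax,x⟩ : x ∈ F, o(Ax) ≤ 1 }`. -/
theorem gap_eq_two_div_osc_sup {n : ℕ} (u : Fin n → ℝ) (hu : u ≠ 0)
    (A : Matrix (Fin n) (Fin n) ℝ) (hA : A.IsSymm)
    (hneg : ∀ x : Fin n → ℝ, x ⬝ᵥ u = 0 → A.mulVec x ⬝ᵥ x ≤ 0)
    (hstrict : ∀ x : Fin n → ℝ, x ⬝ᵥ u = 0 → A.mulVec x ⬝ᵥ x = 0 → x = 0)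
    (hnot : ∃ w : Fin n → ℝ, 0 < A.mulVec w ⬝ᵥ w) :
    sSup (gapSet u A) =
      2 / sSup {r : ℝ | ∃ x : Fin n → ℝ, x ⬝ᵥ u = 0 ∧ osc u (A.mulVec x) ≤ 1 ∧
        r = -(A.mulVec x ⬝ᵥ x)} := by
  rw [← sSup_setOf_forall_mul_le ?_ ?_ zero_le_two]
  · congr 1
    ext G
    rw [mem_gapSet_iff hu hA hneg hstrict]
    refine and_congr_right fun _ => ⟨?_, fun h x hx ho => h _ ⟨x, hx, ho, rfl⟩⟩
    rintro h _ ⟨x, hx, ho, rfl⟩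
    exact h x hx ho
  · exact ⟨_, 0, zero_dotProduct u,
      osc_le_of_abs_sub_mul_le (t := 0) zero_le_one (by simp), rfl⟩
  · rintro _ ⟨x, hx, -, rfl⟩
    exact neg_nonneg.2 (hneg x hx)
end

section
/- Let u ≠ 0 in ℝⁿ, F = {x ∈ ℝⁿ : ⟨x,u⟩ = 0}, and let A be a real symmetric n×n matrix of strict negative type on F but not of negative type on ℝⁿ. Then the negative type gap Γ of A on F satisfies Γ = 2/β, where β = ‖B‖ is the operator norm of B = ⟨A⁻¹u,u⟩⁻¹·(A⁻¹u)(A⁻¹u)ᵀ − A⁻¹ viewed as a linear operator from (ℝⁿ, ‖·‖_∞) to (ℝⁿ, ‖·‖₁). -/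
open Matrix

namespace Matrix

variable {n : ℕ} {A B : Matrix (Fin n) (Fin n) ℝ} {u : Fin n → ℝ}

theorem IsSymm.mulVec_dotProduct (hA : A.IsSymm) (x y : Fin n → ℝ) :
    A.mulVec x ⬝ᵥ y = A.mulVec y ⬝ᵥ x := by
  rw [dotProduct_comm, dotProduct_mulVec, ← mulVec_transpose, hA.eq]

theorem IsSymm.mulVec_dotProduct_sub_smul (hA : A.IsSymm) (x z : Fin n → ℝ) (t : ℝ) :
    A.mulVec (x - t • z) ⬝ᵥ (x - t • z) =
      A.mulVec x ⬝ᵥ x - 2 * t * (A.mulVec z ⬝ᵥ x) + t ^ 2 * (A.mulVec z ⬝ᵥ z) := by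
  have h := hA.mulVec_dotProduct x z
  simp only [mulVec_sub, mulVec_smul, sub_dotProduct, dotProduct_sub, smul_dotProduct,
    dotProduct_smul, smul_eq_mul, h]
  ring

/-- A symmetric matrix of strict negative type on a hyperplane, but not of negative type on the
whole space, is invertible. -/
theorem isUnit_det_of_strict_negative_type (hA : A.IsSymm)
    (hneg : ∀ x : Fin n → ℝ, x ⬝ᵥ u = 0 → A.mulVec x ⬝ᵥ x ≤ 0)
    (hstrict : ∀ x : Fin n → ℝ, x ⬝ᵥ u = 0 → A.mulVec x ⬝ᵥ x = 0 → x = 0)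
    (hnot : ∃ w : Fin n → ℝ, 0 < A.mulVec w ⬝ᵥ w) : IsUnit A.det := by
  rw [isUnit_iff_ne_zero]
  intro hdet
  obtain ⟨x, hx0, hx⟩ := exists_mulVec_eq_zero_iff.mpr hdet
  obtain ⟨w, hw⟩ := hnot
  have hxu : x ⬝ᵥ u ≠ 0 := fun h => hx0 (hstrict x h (by simp [hx]))
  have h := hneg (w - (w ⬝ᵥ u / x ⬝ᵥ u) • x) (by
    simp only [sub_dotProduct, smul_dotProduct, smul_eq_mul]
    field_simp
    ring)
  rw [hA.mulVec_dotProduct_sub_smul, hx] at h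
  simp only [zero_dotProduct, mul_zero, sub_zero, add_zero] at h
  linarith

theorem inv_mulVec_dotProduct_ne_zero (hu : u ≠ 0) (hdet : IsUnit A.det)
    (hstrict : ∀ x : Fin n → ℝ, x ⬝ᵥ u = 0 → A.mulVec x ⬝ᵥ x = 0 → x = 0) :
    A⁻¹.mulVec u ⬝ᵥ u ≠ 0 := by
  intro h
  have hv : A.mulVec (A⁻¹.mulVec u) = u := by
    rw [mulVec_mulVec, mul_nonsing_inv A hdet, one_mulVec]
  have h0 := hstrict _ h (by rw [hv, dotProduct_comm, h])
  rw [h0, mulVec_zero] at hv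
  exact hu hv.symm

theorem abs_dotProduct_le_sum_abs {x y : Fin n → ℝ} (hy : ∀ i, |y i| ≤ 1) :
    |x ⬝ᵥ y| ≤ ∑ i, |x i| := by
  refine (Finset.abs_sum_le_sum_abs _ _).trans (Finset.sum_le_sum fun i _ => ?_)
  rw [abs_mul]
  exact mul_le_of_le_one_right (abs_nonneg _) (hy i)

theorem exists_dotProduct_eq_sum_abs (x : Fin n → ℝ) :
    ∃ y : Fin n → ℝ, (∀ i, |y i| ≤ 1) ∧ y ⬝ᵥ x = ∑ i, |x i| := by
  refine ⟨fun i => SignType.sign (x i), fun i => ?_, ?_⟩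
  · rcases lt_trichotomy (x i) 0 with h | h | h <;> simp [h]
  · exact Finset.sum_congr rfl fun i _ => sign_mul_self (x i)

theorem bddAbove_sum_abs_mulVec (B : Matrix (Fin n) (Fin n) ℝ) :
    BddAbove {r : ℝ | ∃ x : Fin n → ℝ, (∀ i, |x i| ≤ 1) ∧ r = ∑ i, |B.mulVec x i|} := by
  refine ⟨∑ i, ∑ j, |B i j|, ?_⟩
  rintro r ⟨x, hx, rfl⟩
  exact Finset.sum_le_sum fun i _ => abs_dotProduct_le_sum_abs hx

/-- If `B` maps into the hyperplane `F` orthogonal to `u` and `-B` is a one-sided inverse of `A`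
relative to `F`, the gap of `A` on `F` is determined by the norm of `B` from `ℓ^∞` to `ℓ¹`. -/
theorem sSup_gapSet_eq (hA : A.IsSymm)
    (hneg : ∀ x : Fin n → ℝ, x ⬝ᵥ u = 0 → A.mulVec x ⬝ᵥ x ≤ 0)
    (hBu : ∀ y, B.mulVec y ⬝ᵥ u = 0)
    (hAB : ∀ x y : Fin n → ℝ, x ⬝ᵥ u = 0 → A.mulVec (B.mulVec y) ⬝ᵥ x = -(y ⬝ᵥ x)) :
    sSup (gapSet u A) =
      2 / sSup {r : ℝ | ∃ x : Fin n → ℝ, (∀ i, |x i| ≤ 1) ∧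
        r = ∑ i, |B.mulVec x i|} := by
  set S := {r : ℝ | ∃ x : Fin n → ℝ, (∀ i, |x i| ≤ 1) ∧ r = ∑ i, |B.mulVec x i|}
  have hle : ∀ y : Fin n → ℝ, (∀ i, |y i| ≤ 1) → ∑ i, |B.mulVec y i| ≤ sSup S := fun y hy =>
    le_csSup (bddAbove_sum_abs_mulVec B) ⟨y, hy, rfl⟩
  have hne : S.Nonempty := ⟨_, 0, by simp, rfl⟩
  have hβ0 : 0 ≤ sSup S :=
    (Finset.sum_nonneg fun i _ => abs_nonneg _).trans (hle 0 (by simp))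
  have hself : ∀ y : Fin n → ℝ, (∀ i, |y i| ≤ 1) →
      -(A.mulVec (B.mulVec y) ⬝ᵥ B.mulVec y) ≤ ∑ i, |B.mulVec y i| := fun y hy => by
    rw [hAB _ _ (hBu y), neg_neg, dotProduct_comm]
    exact (le_abs_self _).trans (abs_dotProduct_le_sum_abs hy)
  rcases hβ0.eq_or_lt with hβ | hβ
  · have hx0 : ∀ x : Fin n → ℝ, x ⬝ᵥ u = 0 → x = 0 := fun x hx => by
      obtain ⟨y, hy, hyx⟩ := exists_dotProduct_eq_sum_abs x
      have hsum : ∑ i, |B.mulVec y i| = 0 :=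
        le_antisymm (hβ ▸ hle y hy) (Finset.sum_nonneg fun i _ => abs_nonneg _)
      have hBy : B.mulVec y = 0 := funext fun i => abs_eq_zero.mp
        ((Finset.sum_eq_zero_iff_of_nonneg fun i _ => abs_nonneg _).mp hsum i (Finset.mem_univ i))
      have h := hAB x y hx
      rw [hBy, hyx, mulVec_zero, zero_dotProduct, zero_eq_neg] at h
      exact funext fun i => abs_eq_zero.mp
        ((Finset.sum_eq_zero_iff_of_nonneg fun i _ => abs_nonneg _).mp h i (Finset.mem_univ i))
    have hgap : gapSet u A = Set.Ici 0 := by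
      ext G
      refine ⟨fun h => h.1, fun h => ⟨h, fun x hx => ?_⟩⟩
      simp [hx0 x hx]
    rw [hgap, ← hβ, div_zero, Real.sSup_of_not_bddAbove (not_bddAbove_Ici 0)]
  · refine IsGreatest.csSup_eq ⟨⟨by positivity, fun x hx => ?_⟩, ?_⟩
    · obtain ⟨y, hy, hyx⟩ := exists_dotProduct_eq_sum_abs x
      have hq := (hself y hy).trans (hle y hy)
      have h := hneg (x - ((∑ i, |x i|) / sSup S) • B.mulVec y) (by
        rw [sub_dotProduct, smul_dotProduct, hx, hBu, smul_zero, sub_zero])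
      rw [hA.mulVec_dotProduct_sub_smul, hAB x y hx, hyx] at h
      set L := ∑ i, |x i|
      set β := sSup S
      have hmul := mul_le_mul_of_nonneg_left hq (sq_nonneg (L / β))
      have hβ1 : (L / β) ^ 2 * β = L ^ 2 / β := by field_simp
      have hβ2 : L / β * L = L ^ 2 / β := by ring
      have hβ3 : 2 / β / 2 * L ^ 2 = L ^ 2 / β := by ring
      linarith
    · rintro G ⟨hG, hGx⟩
      rw [le_div_iff₀ hβ, mul_comm]
      rcases hG.eq_or_lt with rfl | hG
      · simp
      rw [← le_div_iff₀ hG]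
      refine csSup_le hne ?_
      rintro r ⟨y, hy, rfl⟩
      rw [le_div_iff₀ hG]
      have h1 := hGx _ (hBu y)
      have h2 := hself y hy
      set r := ∑ i, |B.mulVec y i|
      by_contra! hr
      have hr0 : 0 < r := pos_of_mul_pos_left (two_pos.trans hr) hG.le
      nlinarith [mul_pos hr0 (sub_pos.mpr hr)]

end Matrix

/-- For `A` symmetric of strict negative type on `F` and not of negative type on
`ℝⁿ`, the gap `Γ` of `A` on `F` equals `2/β` with `β = ‖B‖` the operator norm of
`B = ⟨A⁻¹u,u⟩⁻¹·(A⁻¹u)(A⁻¹u)ᵀ − A⁻¹` viewed as an operator from `(ℝⁿ,‖·‖_∞)` to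
`(ℝⁿ,‖·‖₁)`. -/
theorem gap_eq_two_div_opNorm {n : ℕ} (u : Fin n → ℝ) (hu : u ≠ 0)
    (A : Matrix (Fin n) (Fin n) ℝ) (hA : A.IsSymm)
    (hneg : ∀ x : Fin n → ℝ, x ⬝ᵥ u = 0 → A.mulVec x ⬝ᵥ x ≤ 0)
    (hstrict : ∀ x : Fin n → ℝ, x ⬝ᵥ u = 0 → A.mulVec x ⬝ᵥ x = 0 → x = 0)
    (hnot : ∃ w : Fin n → ℝ, 0 < A.mulVec w ⬝ᵥ w)
    (B : Matrix (Fin n) (Fin n) ℝ)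
    (hB : B = (A⁻¹.mulVec u ⬝ᵥ u)⁻¹ • vecMulVec (A⁻¹.mulVec u) (A⁻¹.mulVec u) - A⁻¹) :
    sSup (gapSet u A) =
      2 / sSup {r : ℝ | ∃ x : Fin n → ℝ, (∀ i, |x i| ≤ 1) ∧
        r = ∑ i, |B.mulVec x i|} := by
  have hdet := isUnit_det_of_strict_negative_type hA hneg hstrict hnot
  have hs := inv_mulVec_dotProduct_ne_zero hu hdet hstrict
  have hAinv : ∀ y, A.mulVec (A⁻¹.mulVec y) = y := fun y => by
    rw [mulVec_mulVec, mul_nonsing_inv A hdet, one_mulVec]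
  have hsymm : (A⁻¹).IsSymm := by rw [IsSymm, transpose_nonsing_inv, hA.eq]
  have hBy : ∀ y, B.mulVec y =
      ((A⁻¹.mulVec u ⬝ᵥ u)⁻¹ * (A⁻¹.mulVec u ⬝ᵥ y)) • A⁻¹.mulVec u - A⁻¹.mulVec y := fun y => by
    rw [hB, sub_mulVec, smul_mulVec, vecMulVec_mulVec, op_smul_eq_smul, smul_smul]
  refine sSup_gapSet_eq hA hneg (fun y => ?_) fun x y hx => ?_
  · rw [hBy, sub_dotProduct, smul_dotProduct, hsymm.mulVec_dotProduct y u, smul_eq_mul]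
    field_simp
    ring
  · rw [hBy, mulVec_sub, mulVec_smul, hAinv, hAinv, sub_dotProduct, smul_dotProduct,
      dotProduct_comm u x, hx, smul_zero, zero_sub]
end

section
/- For n ≥ 3, the cycle graph Cₙ with n vertices, viewed as a finite metric space with the usual path metric, is of 1-negative type, and it is of strict 1-negative type if and only if n is odd. -/
/-- The path metric of the cycle graph `Cₙ` on vertices `{0,…,n−1}`:
`d(i,j) = min(|i−j|, n−|i−j|)`. -/
def cycleDist (n : ℕ) (i j : Fin n) : ℝ :=
  ((min |(i : ℤ) - (j : ℤ)| ((n : ℤ) - |(i : ℤ) - (j : ℤ)|) : ℤ) : ℝ)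

open Finset in
/-- The half-circle arcs of length `h = n / 2` containing two points at counterclockwise
distance `c`. -/
lemma card_common_arcs (n c : ℕ) (hc : c < n) :
    ((#{t ∈ range n | t % n < n / 2 ∧ (t + c) % n < n / 2} : ℕ) : ℤ)
      = (n / 2 : ℕ) - min (c : ℤ) ((n : ℤ) - c) := by
  have hmod : ∀ t, n ≤ t + c → t < n → (t + c) % n = t + c - n := fun t h1 h2 => by
    rw [Nat.mod_eq_sub_mod h1, Nat.mod_eq_of_lt (by omega)]
  rcases le_or_gt c (n / 2) with h | h
  · have hset : {t ∈ range n | t % n < n / 2 ∧ (t + c) % n < n / 2} = range (n / 2 - c) := by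
      ext t
      simp only [mem_filter, mem_range]
      constructor
      · rintro ⟨h1, h2, h3⟩
        rw [Nat.mod_eq_of_lt h1] at h2
        rw [Nat.mod_eq_of_lt (by omega)] at h3
        omega
      · intro h1
        rw [Nat.mod_eq_of_lt (by omega : t < n), Nat.mod_eq_of_lt (by omega : t + c < n)]
        omega
    rw [hset, card_range]
    omega
  · have hset : {t ∈ range n | t % n < n / 2 ∧ (t + c) % n < n / 2} = Ico (n - c) (n / 2) := by
      ext t
      simp only [mem_filter, mem_range, mem_Ico]
      constructor
      · rintro ⟨h1, h2, h3⟩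
        rw [Nat.mod_eq_of_lt h1] at h2
        refine ⟨?_, h2⟩
        by_contra! h4
        rw [Nat.mod_eq_of_lt (by omega)] at h3
        omega
      · intro h1
        rw [Nat.mod_eq_of_lt (by omega : t < n), hmod t (by omega) (by omega)]
        omega
    rw [hset, Nat.card_Ico]
    omega

/-- Indicator that the point `i`, rotated by `e`, lies in the half-circle arc `[0, n / 2)`. -/
def arcIndicator (n e i : ℕ) : ℝ := if (i + e) % n < n / 2 then 1 else 0

open Finset in
lemma sum_arcIndicator_mul_of_le (n i j : ℕ) (hij : i ≤ j) (hj : j < n) :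
    ∑ e ∈ range n, arcIndicator n e i * arcIndicator n e j
      = (n / 2 : ℕ) - ((min ((j : ℤ) - i) (n - ((j : ℤ) - i)) : ℤ) : ℝ) := by
  let p : ℕ → Prop := fun t => t % n < n / 2 ∧ (t + (j - i)) % n < n / 2
  have hp : Function.Periodic p n := fun t => by
    simp only [p, Nat.add_mod_right, show t + n + (j - i) = t + (j - i) + n by ring]
  have hcard : #{t ∈ Ico i (i + n) | p t} = #{t ∈ range n | p t} := by
    rw [Nat.filter_Ico_card_eq_of_periodic _ _ _ hp, Nat.count_eq_card_filter_range]
  have hsum : ∑ e ∈ range n, arcIndicator n e i * arcIndicator n e j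
      = (#{t ∈ Ico i (i + n) | p t} : ℝ) := by
    rw [card_filter, Nat.cast_sum, sum_Ico_eq_sum_range, Nat.add_sub_cancel_left]
    refine sum_congr rfl fun e _ => ?_
    simp only [arcIndicator, p, show i + e + (j - i) = j + e by omega]
    split_ifs <;> simp_all
  rw [hsum, hcard]
  have h := card_common_arcs n (j - i) (by omega)
  rw [Nat.cast_sub hij] at h
  rw [← Int.cast_natCast, ← Int.cast_natCast (n / 2), ← Int.cast_sub]
  exact congrArg _ h

open Finset in
lemma cycleDist_eq_sub_sum_arcIndicator (n : ℕ) (i j : Fin n) :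
    cycleDist n i j
      = (n / 2 : ℕ) - ∑ e ∈ range n, arcIndicator n e i * arcIndicator n e j := by
  rcases le_total (i : ℕ) j with h | h
  · rw [sum_arcIndicator_mul_of_le n i j h j.2, cycleDist, abs_sub_comm,
      abs_of_nonneg (by omega : (0 : ℤ) ≤ (j : ℤ) - i)]
    ring
  · simp_rw [mul_comm (arcIndicator n _ i)]
    rw [sum_arcIndicator_mul_of_le n j i h i.2, cycleDist,
      abs_of_nonneg (by omega : (0 : ℤ) ≤ (i : ℤ) - j)]
    ring

open Finset in
/-- The quadratic form of the cycle metric is minus a sum of squares of half-circle masses. -/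
lemma sum_mul_cycleDist (n m : ℕ) (y : Fin m → Fin n) (α : Fin m → ℝ) (hα : ∑ i, α i = 0) :
    ∑ i, ∑ j, α i * α j * cycleDist n (y i) (y j)
      = -∑ e ∈ range n, (∑ i, α i * arcIndicator n e (y i)) ^ 2 := by
  have hconst : ∑ i, ∑ j, α i * α j * ((n / 2 : ℕ) : ℝ) = 0 := by
    simp_rw [← sum_mul, ← mul_sum, hα, mul_zero, sum_const_zero, zero_mul]
  simp_rw [cycleDist_eq_sub_sum_arcIndicator, mul_sub, sum_sub_distrib]
  rw [hconst, zero_sub]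
  simp_rw [sq, sum_mul_sum, mul_sum]
  rw [sum_comm (s := range n)]
  congr 1
  refine sum_congr rfl fun i _ => ?_
  rw [sum_comm (s := range n)]
  exact sum_congr rfl fun j _ => sum_congr rfl fun e _ => by ring

/-- For odd `n`, two half-circle arcs and one point partition the cycle. -/
lemma arcIndicator_add_arcIndicator_add_ite {n : ℕ} (hn : Odd n) {a b : ℕ} (ha : a < n)
    (hb : b < n) :
    arcIndicator n (n - 1 - a) b + arcIndicator n ((n - 1 - a + (n / 2 + 1)) % n) b
      + (if b = a then 1 else 0) = 1 := by
  obtain ⟨h, rfl⟩ := hn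
  have hh : (2 * h + 1) / 2 = h := by omega
  simp only [arcIndicator, hh, Nat.add_mod_mod]
  rcases le_or_gt b a with hba | hba
  · rw [Nat.mod_eq_of_lt (by omega : b + (2 * h + 1 - 1 - a) < 2 * h + 1)]
    rcases lt_or_ge (b + (2 * h + 1 - 1 - a)) h with h1 | h1
    · rw [Nat.mod_eq_of_lt (by omega)]
      grind
    · rw [Nat.mod_eq_sub_mod (by omega), Nat.mod_eq_of_lt (by omega)]
      grind
  · rw [Nat.mod_eq_sub_mod (by omega : 2 * h + 1 ≤ b + (2 * h + 1 - 1 - a)),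
      Nat.mod_eq_of_lt (by omega : b + (2 * h + 1 - 1 - a) - (2 * h + 1) < 2 * h + 1),
      Nat.mod_eq_sub_mod (by omega : 2 * h + 1 ≤ b + (2 * h + 1 - 1 - a + (h + 1)))]
    rcases lt_or_ge (b + (2 * h + 1 - 1 - a) - (2 * h + 1)) h with h1 | h1
    · rw [Nat.mod_eq_of_lt (by omega)]
      grind
    · rw [Nat.mod_eq_sub_mod (by omega), Nat.mod_eq_of_lt (by omega)]
      grind

/-- For even `n`, two antipodal edges with alternating signs violate strictness. -/
lemma exists_sum_mul_cycleDist_eq_zero (h : ℕ) (hh : 2 ≤ h) :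
    ∃ (y : Fin 4 → Fin (h + h)) (α : Fin 4 → ℝ), ∑ i, α i = 0 ∧ Function.Injective y ∧
      ∑ i, ∑ j, α i * α j * cycleDist (h + h) (y i) (y j) = 0 ∧ α ≠ 0 := by
  refine ⟨![⟨0, by omega⟩, ⟨1, by omega⟩, ⟨h, by omega⟩, ⟨h + 1, by omega⟩], ![1, -1, 1, -1],
    by simp [Fin.sum_univ_four], ?_, ?_, fun h0 => by simpa using congrFun h0 0⟩
  · intro i j hij
    fin_cases i <;> fin_cases j <;> simp at hij ⊢ <;> omega
  · have hd : ∀ (i j : ℕ) (d : ℤ) (hi : i < h + h) (hj : j < h + h),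
        min (max ((i : ℤ) - j) (-((i : ℤ) - j)))
          (((h + h : ℕ) : ℤ) - max ((i : ℤ) - j) (-((i : ℤ) - j))) = d →
        cycleDist (h + h) ⟨i, hi⟩ ⟨j, hj⟩ = d := by
      rintro i j _ _ _ rfl
      rfl
    simp only [Fin.sum_univ_four, Matrix.cons_val]
    rw [hd 0 0 0 _ _ (by omega), hd 0 1 1 _ _ (by omega),
      hd 0 h h _ _ (by omega), hd 0 (h + 1) (h - 1) _ _ (by omega),
      hd 1 0 1 _ _ (by omega), hd 1 1 0 _ _ (by omega),
      hd 1 h (h - 1) _ _ (by omega), hd 1 (h + 1) h _ _ (by omega),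
      hd h 0 h _ _ (by omega), hd h 1 (h - 1) _ _ (by omega),
      hd h h 0 _ _ (by omega), hd h (h + 1) 1 _ _ (by omega),
      hd (h + 1) 0 (h - 1) _ _ (by omega), hd (h + 1) 1 h _ _ (by omega),
      hd (h + 1) h 1 _ _ (by omega), hd (h + 1) (h + 1) 0 _ _ (by omega)]
    push_cast
    ring

/-- For `n ≥ 3`, the cycle graph `Cₙ` with the usual path metric is of
1-negative type, and it is of strict 1-negative type iff `n` is odd. -/
theorem cycle_negType_and_strict_iff_odd (n : ℕ) (hn : 3 ≤ n) :
    (∀ (m : ℕ) (y : Fin m → Fin n) (α : Fin m → ℝ), (∑ i, α i) = 0 →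
      ∑ i, ∑ j, α i * α j * cycleDist n (y i) (y j) ≤ 0) ∧
    ((∀ (m : ℕ) (y : Fin m → Fin n) (α : Fin m → ℝ), (∑ i, α i) = 0 →
        Function.Injective y →
        ∑ i, ∑ j, α i * α j * cycleDist n (y i) (y j) = 0 → α = 0) ↔ Odd n) := by
  refine ⟨fun m y α hα => ?_, fun hstrict => ?_, fun hodd m y α hα hy h0 => ?_⟩
  · rw [sum_mul_cycleDist n m y α hα, neg_nonpos]
    exact Finset.sum_nonneg fun _ _ => sq_nonneg _
  · by_contra hodd
    obtain ⟨h, rfl⟩ := Nat.not_odd_iff_even.mp hodd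
    obtain ⟨y, α, hα, hy, h0, hne⟩ := exists_sum_mul_cycleDist_eq_zero h (by omega)
    exact hne (hstrict 4 y α hα hy h0)
  · rw [sum_mul_cycleDist n m y α hα, neg_eq_zero,
      Finset.sum_eq_zero_iff_of_nonneg fun _ _ => sq_nonneg _] at h0
    have harc : ∀ e < n, ∑ i, α i * arcIndicator n e (y i) = 0 := fun e he =>
      pow_eq_zero_iff two_ne_zero |>.mp (h0 e (Finset.mem_range.mpr he))
    funext k
    have hpart := Finset.sum_congr rfl fun i (_ : i ∈ Finset.univ) =>
      congrArg (α i * ·) (arcIndicator_add_arcIndicator_add_ite hodd (y k).2 (y i).2)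
    simp only [mul_add, Finset.sum_add_distrib, mul_one, hα, Fin.val_inj, hy.eq_iff] at hpart
    rw [harc _ (by omega), harc _ (Nat.mod_lt _ (by omega))] at hpart
    simpa using hpart
end

section
/- Let k ≥ 1 and let A be the distance matrix of the cycle graph C_{2k+1} with the usual path metric. Let B = ⟨A⁻¹𝟙,𝟙⟩⁻¹·(A⁻¹𝟙)(A⁻¹𝟙)ᵀ − A⁻¹, where 𝟙 = (1,…,1)ᵀ ∈ ℝ^{2k+1}. Then max_{x ∈ {0,1}^{2k+1}} ⟨Bx,x⟩ = (4k² − 2)/(2k + 1). -/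
open Matrix

lemma cycleDist_add_antipodes (k : ℕ) (a b i j : Fin (2 * k + 1)) (ha : a.val = k)
    (hb : b.val = k + 1) :
    2 * cycleDist (2 * k + 1) i j + cycleDist (2 * k + 1) (i + a) j
      + cycleDist (2 * k + 1) (i + b) j = (2 * k + 1) - if i = j then 1 else 0 := by
  have hia := Fin.val_add_eq_ite i a
  have hib := Fin.val_add_eq_ite i b
  rw [ha] at hia
  rw [hb] at hib
  have hi := i.isLt
  have hj := j.isLt
  have key (x y z w : ℤ) (hx : 0 ≤ x ∧ x < 2 * k + 1) (hw : 0 ≤ w ∧ w < 2 * k + 1)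
      (hy : y = x + k ∧ y < 2 * k + 1 ∨ y = x - k - 1 ∧ 0 ≤ y)
      (hz : z = x + k + 1 ∧ z < 2 * k + 1 ∨ z = x - k ∧ 0 ≤ z) :
      2 * min |x - w| (2 * k + 1 - |x - w|) + min |y - w| (2 * k + 1 - |y - w|)
        + min |z - w| (2 * k + 1 - |z - w|) = (2 * k + 1) - if x = w then 1 else 0 := by
    simp only [abs_eq_max_neg]
    omega
  have h := key i (i + a).val (i + b).val j (by omega) (by omega)
    (by split_ifs at hia <;> omega) (by split_ifs at hib <;> omega)
  simp only [Nat.cast_inj, ← Fin.ext_iff] at h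
  unfold cycleDist
  push_cast at h ⊢
  exact_mod_cast h

/-- The circulant matrix `p I + q (Cᵃ + Cᵇ) + c 𝟙𝟙ᵀ` of cyclic shifts by `a` and `b`. -/
def shiftMatrix {n : ℕ} (a b : Fin n) (p q c : ℝ) : Matrix (Fin n) (Fin n) ℝ :=
  of fun i l => p * (if l = i then 1 else 0)
    + q * ((if l = i + a then 1 else 0) + if l = i + b then 1 else 0) + c

lemma shiftMatrix_sum_mul {n : ℕ} (a b : Fin n) (p q c : ℝ) (f : Fin n → ℝ) (i : Fin n) :
    ∑ l, shiftMatrix a b p q c i l * f l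
      = p * f i + q * (f (i + a) + f (i + b)) + c * ∑ l, f l := by
  simp [shiftMatrix, add_mul, mul_add, Finset.sum_add_distrib, ← Finset.mul_sum]

lemma sum_comp_add {n : ℕ} [NeZero n] (f : Fin n → ℝ) (a : Fin n) : ∑ i, f (i + a) = ∑ i, f i :=
  Equiv.sum_comp (Equiv.addRight a) f

lemma sum_cycleDist (k : ℕ) (a b j : Fin (2 * k + 1)) (ha : a.val = k) (hb : b.val = k + 1) :
    ∑ i, cycleDist (2 * k + 1) i j = k * (k + 1) := by
  have h := Finset.sum_congr (rfl : (Finset.univ : Finset (Fin (2 * k + 1))) = _)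
    fun i _ => cycleDist_add_antipodes k a b i j ha hb
  rw [Finset.sum_add_distrib, Finset.sum_add_distrib, ← Finset.mul_sum,
    sum_comp_add (fun i => cycleDist (2 * k + 1) i j),
    sum_comp_add (fun i => cycleDist (2 * k + 1) i j), Finset.sum_sub_distrib] at h
  simp at h
  linarith

lemma inv_eq_shiftMatrix (k : ℕ) (hk : 1 ≤ k) (a b : Fin (2 * k + 1)) (ha : a.val = k)
    (hb : b.val = k + 1) (A : Matrix (Fin (2 * k + 1)) (Fin (2 * k + 1)) ℝ)
    (hA : ∀ i j, A i j = cycleDist (2 * k + 1) i j) :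
    A⁻¹ = shiftMatrix a b (-2) (-1) ((2 * k + 1) / (k * (k + 1))) := by
  apply Matrix.inv_eq_left_inv
  ext i j
  have hk' : (k : ℝ) ≠ 0 := by positivity
  rw [Matrix.mul_apply, shiftMatrix_sum_mul a b _ _ _ (fun l => A l j), Matrix.one_apply]
  simp only [hA]
  rw [sum_cycleDist k a b j ha hb, div_mul_cancel₀ _ (by positivity)]
  linarith [cycleDist_add_antipodes k a b i j ha hb]

lemma quadratic_eq_shiftMatrix (k : ℕ) (hk : 1 ≤ k) (a b : Fin (2 * k + 1)) (ha : a.val = k)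
    (hb : b.val = k + 1) (A : Matrix (Fin (2 * k + 1)) (Fin (2 * k + 1)) ℝ)
    (hA : ∀ i j, A i j = cycleDist (2 * k + 1) i j) :
    (A⁻¹.mulVec (fun _ => 1) ⬝ᵥ (fun _ => 1))⁻¹ •
        vecMulVec (A⁻¹.mulVec fun _ => 1) (A⁻¹.mulVec fun _ => 1) - A⁻¹
      = shiftMatrix a b 2 1 (-4 / (2 * k + 1)) := by
  have hk' : (k : ℝ) ≠ 0 := by positivity
  have hn : (2 * k + 1 : ℝ) ≠ 0 := by positivity
  have hm : A⁻¹.mulVec (fun _ => 1) = fun _ => (1 / (k * (k + 1)) : ℝ) := by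
    ext i
    rw [inv_eq_shiftMatrix k hk a b ha hb A hA, mulVec, dotProduct, shiftMatrix_sum_mul]
    simp
    field_simp
    ring
  rw [hm, inv_eq_shiftMatrix k hk a b ha hb A hA]
  have hd : (fun _ : Fin (2 * k + 1) => (1 / (k * (k + 1)) : ℝ)) ⬝ᵥ (fun _ => 1)
      = (2 * k + 1) / (k * (k + 1)) := by
    simp [dotProduct, div_eq_mul_inv]
  ext i j
  simp only [hd, Matrix.sub_apply, Matrix.smul_apply, vecMulVec_apply, shiftMatrix, of_apply, smul_eq_mul]
  field_simp
  ring

lemma shiftMatrix_quadratic {n : ℕ} [NeZero n] (a b : Fin n) (hab : a + b = 0) (c : ℝ)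
    (x : Fin n → ℝ) (hx : ∀ i, x i = 0 ∨ x i = 1) :
    (shiftMatrix a b 2 1 c).mulVec x ⬝ᵥ x
      = 2 * ∑ i, x i + 2 * ∑ i, x i * x (i + b) + c * (∑ i, x i) ^ 2 := by
  have h2 : ∑ i, x i * x i = ∑ i, x i :=
    Finset.sum_congr rfl fun i _ => by rcases hx i with h | h <;> simp [h]
  have h3 : ∑ i, x (i + a) * x i = ∑ i, x i * x (i + b) := by
    rw [← sum_comp_add (fun i => x i * x (i + b)) a]
    simp [add_assoc, hab]
  simp only [mulVec, dotProduct, shiftMatrix_sum_mul]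
  simp only [add_mul, one_mul, Finset.sum_add_distrib, mul_assoc, ← Finset.mul_sum, h2, h3]
  simp only [mul_comm (x (_ + b))]
  ring

open scoped Fin.CommRing in
lemma sum_mul_shift_le {n : ℕ} [NeZero n] (b : Fin n) (hb : b + b = 1)
    (x : Fin n → ℝ) (hx : ∀ i, x i = 0 ∨ x i = 1) :
    (∀ i, x i = 0) ∨ (∀ i, x i = 1) ∨ ∑ i, x i * x (i + b) ≤ ∑ i, x i - 1 := by
  by_cases h : ∀ i, x i = 1 → x (i + b) = 1
  · by_cases h0 : ∀ i, x i = 0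
    · exact Or.inl h0
    right; left
    push Not at h0
    obtain ⟨i₀, hi₀⟩ := h0
    have h1 : ∀ m : ℕ, x (i₀ + m • (1 : Fin n)) = 1 := by
      intro m
      induction m with
      | zero => simpa using (hx i₀).resolve_left hi₀
      | succ m ih =>
        rw [succ_nsmul, ← hb, ← add_assoc, ← add_assoc, hb]
        exact h _ (h _ ih)
    intro i
    have h2 := h1 (i - i₀).val
    rwa [show (i - i₀).val • (1 : Fin n) = i - i₀ by simp [nsmul_eq_mul], add_sub_cancel] at h2
  · right; right
    push Not at h
    obtain ⟨i, hi, hi'⟩ := h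
    have hle : x i * (1 - x (i + b)) ≤ ∑ j, x j * (1 - x (j + b)) :=
      Finset.single_le_sum (f := fun j => x j * (1 - x (j + b)))
        (fun j _ => by
          rcases hx j with h | h <;> rcases hx (j + b) with h' | h' <;> simp [h, h'])
        (Finset.mem_univ i)
    rw [hi, (hx (i + b)).resolve_right hi'] at hle
    simp only [mul_sub, mul_one, Finset.sum_sub_distrib] at hle
    linarith

lemma sum_initial_segment (n m : ℕ) (h : m ≤ n) :
    ∑ j : Fin n, (if j.val < m then (1 : ℝ) else 0) = m := by
  rw [Fin.sum_univ_eq_sum_range (fun j => if j < m then (1 : ℝ) else 0), Finset.sum_boole]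
  congr 1
  rw [show (Finset.range n).filter (· < m) = Finset.range m by ext; simp; omega,
    Finset.card_range]

/-- For `k ≥ 1`, with `A` the distance matrix of `C_{2k+1}` and
`B = ⟨A⁻¹𝟙,𝟙⟩⁻¹·(A⁻¹𝟙)(A⁻¹𝟙)ᵀ − A⁻¹`, the maximum of `⟨Bx,x⟩` over `x ∈ {0,1}^{2k+1}` is
`(4k²−2)/(2k+1)`. -/
theorem cycle_max_B_quadratic (k : ℕ) (hk : 1 ≤ k)
    (A : Matrix (Fin (2 * k + 1)) (Fin (2 * k + 1)) ℝ)
    (hA : ∀ i j, A i j = cycleDist (2 * k + 1) i j)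
    (B : Matrix (Fin (2 * k + 1)) (Fin (2 * k + 1)) ℝ)
    (hB : B = (A⁻¹.mulVec (fun _ => 1) ⬝ᵥ (fun _ => 1))⁻¹ •
        vecMulVec (A⁻¹.mulVec fun _ => 1) (A⁻¹.mulVec fun _ => 1) - A⁻¹) :
    IsGreatest {r : ℝ | ∃ x : Fin (2 * k + 1) → ℝ, (∀ i, x i = 0 ∨ x i = 1) ∧
        r = B.mulVec x ⬝ᵥ x}
      ((4 * (k : ℝ) ^ 2 - 2) / (2 * (k : ℝ) + 1)) := by
  let a : Fin (2 * k + 1) := ⟨k, by omega⟩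
  let b : Fin (2 * k + 1) := ⟨k + 1, by omega⟩
  have hab : a + b = 0 := by
    ext
    simp [Fin.val_add, a, b, show k + (k + 1) = 2 * k + 1 by ring]
  have hbb : b + b = 1 := by
    ext
    simp only [Fin.val_add, b, Fin.val_one']
    rw [show k + 1 + (k + 1) = 1 + (2 * k + 1) by ring, Nat.add_mod_right]
  have hk1 : (1 : ℝ) ≤ k := by exact_mod_cast hk
  have hn : (0 : ℝ) < 2 * k + 1 := by positivity
  rw [quadratic_eq_shiftMatrix k hk a b rfl rfl A hA] at hB
  subst hB
  constructor
  · let g : Fin (2 * k + 1) → ℝ := fun j => if j.val < k then 1 else 0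
    have hg : ∀ i, g i = 0 ∨ g i = 1 := fun i => by by_cases h : i.val < k <;> simp [g, h]
    have hdouble : Function.Bijective fun i : Fin (2 * k + 1) => i + i := by
      rw [← Finite.injective_iff_bijective]
      intro i j hij
      have hij : (i + i).val = (j + j).val := congrArg Fin.val hij
      simp only [Fin.val_add_eq_ite] at hij
      ext
      split_ifs at hij <;> omega
    have hsum : ∑ i, g (i + i) = k := by
      rw [hdouble.sum_comp g]
      exact sum_initial_segment _ _ (by omega)
    have hadj : ∑ i, g (i + i) * g (i + b + (i + b)) = (k : ℝ) - 1 := by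
      simp only [add_add_add_comm _ b, hbb]
      rw [hdouble.sum_comp fun j => g j * g (j + 1)]
      have h := sum_initial_segment (2 * k + 1) (k - 1) (by omega)
      rw [Nat.cast_sub hk, Nat.cast_one] at h
      rw [← h]
      refine Finset.sum_congr rfl fun j _ => ?_
      by_cases hj : j.val < k
      · have : (j + 1).val = j.val + 1 := by
          rw [Fin.val_add, Fin.val_one', Nat.mod_eq_of_lt (a := 1) (by omega),
            Nat.mod_eq_of_lt (by omega)]
        simp only [g, hj, this, if_true, one_mul]
        exact if_congr (by omega) rfl rfl
      · simp [g, hj, show ¬ j.val < k - 1 by omega]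
    refine ⟨fun i => g (i + i), fun i => hg _, ?_⟩
    rw [shiftMatrix_quadratic a b hab _ _ fun i => hg _, hsum, hadj]
    field_simp
    ring
  · rintro r ⟨x, hx, rfl⟩
    rw [shiftMatrix_quadratic a b hab _ _ hx, le_div_iff₀ hn]
    rcases sum_mul_shift_le b hbb x hx with h | h | h
    · simp [h]
      nlinarith
    · simp [h]
      field_simp
      nlinarith
    · obtain ⟨m, hm⟩ : ∃ m : ℤ, ∑ i, x i = m := by
        choose y hy using fun i => show ∃ y : ℤ, x i = y from
          (hx i).elim (fun h => ⟨0, by simp [h]⟩) fun h => ⟨1, by simp [h]⟩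
        exact ⟨∑ i, y i, by simp [hy]⟩
      rw [hm] at h ⊢
      have hsq : (1 : ℝ) ≤ (2 * k + 1 - 2 * m) ^ 2 := by
        have : (1 : ℤ) ≤ (2 * k + 1 - 2 * m) ^ 2 := by
          have : (2 * k + 1 - 2 * m : ℤ) ≠ 0 := by omega
          have := sq_pos_of_ne_zero this
          omega
        exact_mod_cast this
      have hc : (-4 / (2 * k + 1) * (m : ℝ) ^ 2) * (2 * k + 1) = -4 * m ^ 2 := by
        field_simp
      nlinarith [mul_le_mul_of_nonneg_right h hn.le]
end
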